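/- arXiv:1708.06460 — 3 statements merged into one kernel-verified Lean document; each statement's English description precedes it below -/
import Mathlib

section
/- Let s, t ≥ 1 be integers, let A be an s × t matrix with integer entries of rank r, and let b ∈ ℤ^s. Let M be the maximum of the absolute values of the r × r sub-determinants of the extended matrix (A | b), and let S ⊆ ℕ^t be the set of minimal elements (with respect to the componentwise order) of the set { x ∈ ℕ^t \ {0} : A x = b }. Then every vector in S has maximum norm at most (t+1)·M. -/
open Matrix in
lemma reduce_aux {n : ℕ} (z u : Fin n → ℚ) (hz : ∀ j, 0 ≤ z j)
    (hsupp : ∀ j, z j = 0 → u j = 0) (hpos : ∃ j, 0 < u j) :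
    ∃ l : ℚ, 0 ≤ l ∧ (∀ j, 0 ≤ z j - l * u j) ∧ ∃ j, z j ≠ 0 ∧ z j - l * u j = 0 := by
  obtain ⟨j1, hj1⟩ := hpos
  obtain ⟨k, hk, hmin⟩ := Finset.exists_min_image
    (Finset.univ.filter fun j => 0 < u j) (fun j => z j / u j) ⟨j1, by simpa using hj1⟩
  simp only [Finset.mem_filter, Finset.mem_univ, true_and] at hk hmin
  have hl : 0 ≤ z k / u k := div_nonneg (hz k) hk.le
  refine ⟨z k / u k, hl, fun j => ?_, k, fun h => ?_, ?_⟩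
  · rcases lt_or_ge 0 (u j) with h | h
    · have := hmin j h
      rw [le_div_iff₀ h] at this
      linarith
    · have := mul_nonneg hl (neg_nonneg.2 h)
      have := hz j
      linarith
  · exact hk.ne' (hsupp k h)
  · field_simp
    simp

open Matrix in
lemma exists_rows {s r : ℕ} (C : Matrix (Fin s) (Fin r) ℚ) (h : LinearIndependent ℚ C.col) :
    ∃ ρ : Fin r → Fin s, Function.Injective ρ ∧ (C.submatrix ρ id).det ≠ 0 := by
  have hrk : C.rank = r := by
    rw [rank_eq_finrank_span_cols, finrank_span_eq_card h, Fintype.card_fin]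
  obtain ⟨κ, a, ha, hsp, hli⟩ := exists_linearIndependent' ℚ C.row
  have : Fintype κ := Fintype.ofInjective a ha
  have hc : Fintype.card κ = r := by
    rw [← finrank_span_eq_card hli, hsp, ← rank_eq_finrank_span_row, hrk]
  let e := (Fintype.equivFinOfCardEq hc).symm
  refine ⟨a ∘ e, ha.comp e.injective, ?_⟩
  have h2 : LinearIndependent ℚ (C.submatrix (a ∘ e) id).row := hli.comp e e.injective
  rw [linearIndependent_rows_iff_isUnit, isUnit_iff_isUnit_det] at h2
  exact h2.ne_zero

open Matrix in
lemma circuit_base {s n r M : ℕ} (B : Matrix (Fin s) (Fin n) ℤ)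
    (hr : r = (B.map ((↑) : ℤ → ℚ)).rank)
    (hM : ∀ (ρ : Fin r → Fin s) (σ : Fin r → Fin n),
      Function.Injective ρ → Function.Injective σ → ((B.submatrix ρ σ).det).natAbs ≤ M)
    (z : Fin n → ℚ) (hz : ∀ j, 0 ≤ z j) (hB : (B.map ((↑) : ℤ → ℚ)) *ᵥ z = 0)
    (j0 : Fin n) (hj0 : z j0 ≠ 0)
    (hli : LinearIndepOn ℚ (B.map ((↑) : ℤ → ℚ)).col
      (((Finset.univ.filter fun j => z j ≠ 0).erase j0 : Finset (Fin n)) : Set (Fin n))) :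
    ∃ v : Fin n → ℕ, v ≠ 0 ∧ (B.map ((↑) : ℤ → ℚ)) *ᵥ (fun j => (v j : ℚ)) = 0 ∧
      (∀ j, v j ≤ M) ∧ ∀ j, z j = 0 → v j = 0 := by
  classical
  set Q := B.map ((↑) : ℤ → ℚ) with hQ
  obtain ⟨J, -, hTJ, hsp, hJ⟩ := exists_linearIndepOn_extension hli (Set.subset_univ _)
  have hj0J : j0 ∉ J := by
    intro hmem
    have hsub : ((Finset.univ.filter fun j => z j ≠ 0 : Finset (Fin n)) : Set (Fin n)) ⊆ J := by
      intro j hj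
      by_cases h : j = j0
      · exact h ▸ hmem
      · exact hTJ (by simpa [h] using hj)
    have := linearIndepOn_finset_iff.1 (hJ.mono hsub) z (by
      rw [Finset.sum_filter_of_ne (by intro x _ h; exact left_ne_zero_of_smul h)]
      rw [← hB]
      ext i
      simp [mulVec, dotProduct, mul_comm])
    exact hj0 (this j0 (by simpa using hj0))
  have hc : Fintype.card J = r := by
    have h1 : LinearIndependent ℚ (fun x : J => Q.col x) := hJ
    rw [← finrank_span_eq_card h1, hr, rank_eq_finrank_span_cols]
    suffices h : Submodule.span ℚ (Set.range fun x : J => Q.col x)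
        = Submodule.span ℚ (Set.range Q.col) by rw [h]
    apply le_antisymm
    · exact Submodule.span_mono (by rintro _ ⟨x, rfl⟩; exact ⟨x, rfl⟩)
    · rw [Submodule.span_le]
      have : Set.range (fun x : J => Q.col x) = Q.col '' J := by
        ext; simp
      rw [this]
      simpa using hsp
  let e := (Fintype.equivFinOfCardEq hc).symm
  let σ : Fin r → Fin n := fun k => (e k : Fin n)
  have hσ : Function.Injective σ := Subtype.val_injective.comp e.injective
  have hσj0 : ∀ k, σ k ≠ j0 := fun k h => hj0J (h ▸ (e k).2)
  obtain ⟨ρ, hρ, hdet⟩ := exists_rows (Q.submatrix id σ) (by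
    exact LinearIndependent.comp (hJ : LinearIndependent ℚ (fun x : J => Q.col x)) e e.injective)
  let D := B.submatrix ρ σ
  have hDQ : D.map ((↑) : ℤ → ℚ) = (Q.submatrix id σ).submatrix ρ id := rfl
  have hDdet : ((D.det : ℤ) : ℚ) ≠ 0 := by
    rw [← hDQ] at hdet
    have : ((D.det : ℤ) : ℚ) = (D.map ((↑) : ℤ → ℚ)).det := Int.cast_det D
    rwa [this]
  have hinj := mulVec_injective_iff_isUnit.2
    ((isUnit_iff_isUnit_det _).2 (isUnit_iff_ne_zero.2 hdet))
  -- Cramer numerators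
  let c : Fin r → ℤ := D.cramer (fun i => B (ρ i) j0)
  have hcb : ∀ k, (c k).natAbs ≤ M := by
    intro k
    have : c k = (B.submatrix ρ (Function.update σ k j0)).det := by
      show (D.updateCol k _).det = _
      congr 1
      ext i j
      by_cases h : j = k
      · subst h; simp
      · simp [h, D]
    rw [this]
    apply hM _ _ hρ
    intro x y hxy
    simp only [Function.update_apply] at hxy
    split_ifs at hxy with h1 h2 h2
    · rw [h1, h2]
    · exact (hσj0 _ hxy.symm).elim
    · exact (hσj0 _ hxy).elim
    · exact hσ hxy
  have hcr : D *ᵥ c = D.det • (fun i => B (ρ i) j0) := mulVec_cramer _ _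
  have hsum : ∀ i, (∑ k, Q i (σ k) * z (σ k)) + Q i j0 * z j0 = 0 := by
    intro i
    have h1 := congrFun hB i
    simp only [mulVec, dotProduct, Pi.zero_apply] at h1
    rw [← h1, ← Finset.sum_image (s := Finset.univ) (g := σ) (f := fun j => Q i j * z j)
      hσ.injOn]
    rw [add_comm, ← Finset.sum_insert (f := fun j => Q i j * z j)
      (by simpa using hσj0)]
    apply Finset.sum_subset (Finset.subset_univ _)
    intro j _ hj
    by_contra hne
    have hzj : z j ≠ 0 := right_ne_zero_of_mul hne
    apply hj
    by_cases hjj : j = j0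
    · simp [hjj]
    · have : j ∈ J := hTJ (by simp [hjj, hzj])
      simp only [Finset.mem_insert, Finset.mem_image, Finset.mem_univ, true_and]
      exact Or.inr ⟨e.symm ⟨j, this⟩, by simp [σ]⟩
  have hkey : ∀ k, (D.det : ℚ) * z (σ k) = - (z j0 * c k) := by
    have : (fun k => (D.det : ℚ) * z (σ k)) = fun k => - (z j0 * c k) := by
      apply hinj
      ext i
      have h1 : (∑ k, Q (ρ i) (σ k) * (c k : ℚ)) = D.det * Q (ρ i) j0 := by
        have := congrFun hcr i
        simp only [mulVec, dotProduct, Pi.smul_apply, smul_eq_mul] at this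
        have h2 := congrArg ((↑) : ℤ → ℚ) this
        simp only [Int.cast_sum, Int.cast_mul] at h2
        exact h2
      have h3 := hsum (ρ i)
      show ∑ k, Q (ρ i) (σ k) * ((D.det : ℚ) * z (σ k)) = ∑ k, Q (ρ i) (σ k) * (- (z j0 * c k))
      have e1 : ∑ k, Q (ρ i) (σ k) * ((D.det : ℚ) * z (σ k))
          = D.det * ∑ k, Q (ρ i) (σ k) * z (σ k) := by
        rw [Finset.mul_sum]; exact Finset.sum_congr rfl fun _ _ => by ring
      have e2 : ∑ k, Q (ρ i) (σ k) * (- (z j0 * c k))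
          = - z j0 * ∑ k, Q (ρ i) (σ k) * (c k : ℚ) := by
        rw [Finset.mul_sum]; exact Finset.sum_congr rfl fun _ _ => by ring
      rw [e1, e2, h1]
      linear_combination (D.det : ℚ) * h3
    exact fun k => congrFun this k
  have hz0 : 0 < z j0 := lt_of_le_of_ne (hz j0) (Ne.symm hj0)
  have hex : ∀ j, ∃ m : ℕ, (m : ℚ) = |(D.det : ℚ)| / z j0 * z j ∧ m ≤ M := by
    intro j
    by_cases hjj : j = j0
    · refine ⟨D.det.natAbs, ?_, hM _ _ hρ hσ⟩
      rw [Nat.cast_natAbs, hjj]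
      push_cast
      field_simp
    by_cases hzj : z j = 0
    · exact ⟨0, by simp [hzj], Nat.zero_le _⟩
    have hJj : j ∈ J := hTJ (by simp [hjj, hzj])
    have hk : σ (e.symm ⟨j, hJj⟩) = j := by simp [σ]
    refine ⟨(c (e.symm ⟨j, hJj⟩)).natAbs, ?_, hcb _⟩
    have h1 := congrArg abs (hkey (e.symm ⟨j, hJj⟩))
    rw [hk, abs_mul, abs_neg, abs_mul, abs_of_pos hz0, abs_of_nonneg (hz j)] at h1
    rw [Nat.cast_natAbs, Int.cast_abs]
    field_simp
    linarith
  choose v hv hvM using hex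
  refine ⟨v, ?_, ?_, hvM, ?_⟩
  · intro h
    have h1 := hv j0
    rw [h] at h1
    have : 0 < |(D.det : ℚ)| / z j0 * z j0 := by positivity
    rw [← h1] at this
    simp at this
  · have : (fun j => (v j : ℚ)) = (|(D.det : ℚ)| / z j0) • z := by
      ext j; simp [hv]
    rw [this, mulVec_smul, hB, smul_zero]
  · intro j hj
    have := hv j
    rw [hj, mul_zero] at this
    exact_mod_cast this

open Matrix in
lemma circuit_exists {s n r M : ℕ} (B : Matrix (Fin s) (Fin n) ℤ)
    (hr : r = (B.map ((↑) : ℤ → ℚ)).rank)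
    (hM : ∀ (ρ : Fin r → Fin s) (σ : Fin r → Fin n),
      Function.Injective ρ → Function.Injective σ → ((B.submatrix ρ σ).det).natAbs ≤ M)
    (N : ℕ) : ∀ (z : Fin n → ℚ), (∀ j, 0 ≤ z j) → (B.map ((↑) : ℤ → ℚ)) *ᵥ z = 0 →
    z ≠ 0 → (Finset.univ.filter fun j => z j ≠ 0).card ≤ N →
    ∃ v : Fin n → ℕ, v ≠ 0 ∧ (B.map ((↑) : ℤ → ℚ)) *ᵥ (fun j => (v j : ℚ)) = 0 ∧
      (∀ j, v j ≤ M) ∧ ∀ j, z j = 0 → v j = 0 := by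
  classical
  induction N with
  | zero =>
    intro z _ _ hne hcard
    exfalso
    apply hne
    ext j
    by_contra h
    have : j ∈ (Finset.univ.filter fun j => z j ≠ 0) := by simpa using h
    rw [Finset.card_eq_zero.1 (Nat.le_zero.1 hcard)] at this
    simp at this
  | succ N ih =>
    intro z hz hB hne hcard
    obtain ⟨j0, hj0⟩ := Function.ne_iff.1 hne
    by_cases hli : LinearIndepOn ℚ (B.map ((↑) : ℤ → ℚ)).col
      (((Finset.univ.filter fun j => z j ≠ 0).erase j0 : Finset (Fin n)) : Set (Fin n))
    · exact circuit_base B hr hM z hz hB j0 hj0 hli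
    rw [linearIndepOn_finset_iff] at hli
    push Not at hli
    obtain ⟨f, hf, i, hi, hfi⟩ := hli
    have hu : ∃ u : Fin n → ℚ, (B.map ((↑) : ℤ → ℚ)) *ᵥ u = 0 ∧ (∀ j, z j = 0 → u j = 0) ∧
        u j0 = 0 ∧ ∃ j, 0 < u j := by
      let u : Fin n → ℚ := fun j =>
        if j ∈ (Finset.univ.filter fun j => z j ≠ 0).erase j0 then f j else 0
      have h1 : (B.map ((↑) : ℤ → ℚ)) *ᵥ u = 0 := by
        rw [← hf]
        ext k
        simp only [mulVec, dotProduct, u, mul_ite, mul_zero, Finset.sum_ite_mem,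
          Finset.univ_inter, Finset.sum_apply, Pi.smul_apply, smul_eq_mul, col_apply]
        exact Finset.sum_congr rfl fun _ _ => mul_comm _ _
      have h2 : ∀ j, z j = 0 → u j = 0 := by intro j hj; simp [u, hj]
      have h3 : u j0 = 0 := by simp [u]
      have h4 : u i ≠ 0 := by simp only [u, if_pos hi]; exact hfi
      rcases lt_or_gt_of_ne h4 with h | h
      · exact ⟨-u, by rw [mulVec_neg, h1, neg_zero], fun j hj => by simp [h2 j hj],
          by simp [h3], i, by simpa using h⟩
      · exact ⟨u, h1, h2, h3, i, h⟩
    obtain ⟨u, hu1, hu2, hu3, hu4⟩ := hu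
    obtain ⟨l, hl, hl2, k, hk1, hk2⟩ := reduce_aux z u hz hu2 hu4
    have hsub : ∀ j, z j = 0 → (z - l • u) j = 0 := by
      intro j hj; simp [hj, hu2 j hj]
    obtain ⟨v, hv1, hv2, hv3, hv4⟩ := ih (z - l • u) (fun j => by simpa using hl2 j)
      (by rw [mulVec_sub, mulVec_smul, hB, hu1]; simp)
      (by
        intro h
        have := congrFun h j0
        simp [hu3] at this
        exact hj0 this)
      (by
        apply Nat.le_of_lt_succ
        refine lt_of_lt_of_le (Finset.card_lt_card ?_) hcard
        rw [Finset.ssubset_iff_of_subset]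
        · exact ⟨k, by simpa using hk1, by simpa using hk2⟩
        · intro j hj
          simp only [Finset.mem_filter, Finset.mem_univ, true_and] at hj ⊢
          exact fun h => hj (hsub j h))
    exact ⟨v, hv1, hv2, hv3, fun j hj => hv4 j (hsub j hj)⟩

open Matrix in
lemma decompose {s n r M : ℕ} (B : Matrix (Fin s) (Fin n) ℤ)
    (hr : r = (B.map ((↑) : ℤ → ℚ)).rank)
    (hM : ∀ (ρ : Fin r → Fin s) (σ : Fin r → Fin n),
      Function.Injective ρ → Function.Injective σ → ((B.submatrix ρ σ).det).natAbs ≤ M)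
    (N : ℕ) : ∀ (z : Fin n → ℚ), (∀ j, 0 ≤ z j) → (B.map ((↑) : ℤ → ℚ)) *ᵥ z = 0 →
    (Finset.univ.filter fun j => z j ≠ 0).card ≤ N →
    ∃ (v : Fin N → Fin n → ℕ) (l : Fin N → ℚ), (∀ i, 0 ≤ l i) ∧
      (∀ i, l i ≠ 0 → v i ≠ 0) ∧
      (∀ i, (B.map ((↑) : ℤ → ℚ)) *ᵥ (fun j => (v i j : ℚ)) = 0) ∧
      (∀ i j, v i j ≤ M) ∧ ∀ j, z j = ∑ i, l i * v i j := by
  classical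
  induction N with
  | zero =>
    intro z _ _ hcard
    refine ⟨fun _ _ => 0, fun _ => 0, by simp, by simp, fun i => i.elim0, by simp, ?_⟩
    intro j
    by_contra h
    have : j ∈ (Finset.univ.filter fun j => z j ≠ 0) := by simpa using h
    rw [Finset.card_eq_zero.1 (Nat.le_zero.1 hcard)] at this
    simp at this
  | succ N ih =>
    intro z hz hB hcard
    by_cases hne : z = 0
    · refine ⟨fun _ _ => 0, fun _ => 0, by simp, by simp, fun i => ?_, by simp, by simp [hne]⟩
      ext k
      simp [mulVec, dotProduct]
    obtain ⟨v, hv1, hv2, hv3, hv4⟩ := circuit_exists B hr hM (N + 1) z hz hB hne hcard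
    obtain ⟨l, hl, hl2, k, hk1, hk2⟩ := reduce_aux z (fun j => (v j : ℚ)) hz
      (fun j hj => by simp [hv4 j hj]) (by
        obtain ⟨j, hj⟩ := Function.ne_iff.1 hv1
        exact ⟨j, by exact_mod_cast Nat.pos_of_ne_zero hj⟩)
    obtain ⟨w, m, h1, h2, h3, h4, h5⟩ := ih (z - l • (fun j => (v j : ℚ)))
      (fun j => by simpa using hl2 j)
      (by rw [mulVec_sub, mulVec_smul, hB, hv2]; simp)
      (by
        apply Nat.le_of_lt_succ
        refine lt_of_lt_of_le (Finset.card_lt_card ?_) hcard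
        rw [Finset.ssubset_iff_of_subset]
        · exact ⟨k, by simpa using hk1, by simpa using hk2⟩
        · intro j hj
          simp only [Finset.mem_filter, Finset.mem_univ, true_and] at hj ⊢
          exact fun h => hj (by simp [h, hv4 j h]))
    refine ⟨Fin.cons v w, Fin.cons l m, ?_, ?_, ?_, ?_, ?_⟩
    · intro i; refine Fin.cases ?_ ?_ i <;> simp [hl, h1]
    · intro i; refine Fin.cases ?_ ?_ i
      · intro _; simpa using hv1
      · intro i; simpa using h2 i
    · intro i; refine Fin.cases ?_ ?_ i
      · simpa using hv2
      · intro i; simpa using h3 i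
    · intro i; refine Fin.cases ?_ ?_ i
      · simpa using hv3
      · intro i; simpa using h4 i
    · intro j
      rw [Fin.sum_univ_succ]
      have := h5 j
      simp only [Pi.sub_apply, Pi.smul_apply, smul_eq_mul] at this
      simp only [Fin.cons_zero, Fin.cons_succ]
      linarith

/-- Huet-style bound on minimal solutions of `A x = b` over the naturals:
every minimal nonzero solution has maximum norm at most `(t+1) * M`, where `M`
bounds the absolute values of the `r × r` sub-determinants of the extended
matrix `(A | b)` and `r` is the rank of `A` (over `ℚ`). -/
theorem minimal_solution_bound (s t : ℕ) (hs : 1 ≤ s) (ht : 1 ≤ t)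
    (A : Matrix (Fin s) (Fin t) ℤ) (b : Fin s → ℤ) (r M : ℕ)
    (hr : r = (A.map ((↑) : ℤ → ℚ)).rank)
    (Aext : Matrix (Fin s) (Fin (t + 1)) ℤ)
    (hAext : ∀ (i : Fin s) (j : Fin (t + 1)),
      Aext i j = if h : (j : ℕ) < t then A i ⟨(j : ℕ), h⟩ else b i)
    (hM : ∀ (ρ : Fin r → Fin s) (σ : Fin r → Fin (t + 1)),
      Function.Injective ρ → Function.Injective σ →
      ((Aext.submatrix ρ σ).det).natAbs ≤ M)
    (S : Set (Fin t → ℕ))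
    (hS : S = {x | (x ≠ 0 ∧ A.mulVec (fun i => (x i : ℤ)) = b) ∧
      ∀ y : Fin t → ℕ, (y ≠ 0 ∧ A.mulVec (fun i => (y i : ℤ)) = b) → y ≤ x → y = x}) :
    ∀ x ∈ S, Finset.univ.sup x ≤ (t + 1) * M := by
  classical
  intro x hx
  rw [hS] at hx
  obtain ⟨⟨hx0, hAx⟩, hmin⟩ := hx
  -- the homogenised matrix `(A | -b)`
  let d : Fin (t + 1) → ℤ := fun j => if (j : ℕ) < t then 1 else -1
  let B : Matrix (Fin s) (Fin (t + 1)) ℤ := Matrix.of fun i j => d j * Aext i j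
  have hBc : ∀ i (j : Fin t), B i j.castSucc = A i j := by
    intro i j; simp [B, d, hAext]
  have hBl : ∀ i, B i (Fin.last t) = - b i := by
    intro i; simp [B, d, hAext]
  have hBmul : ∀ (w : Fin (t + 1) → ℚ) (i : Fin s),
      Matrix.mulVec (B.map ((↑) : ℤ → ℚ)) w i
        = (∑ j : Fin t, (A i j : ℚ) * w j.castSucc) - b i * w (Fin.last t) := by
    intro w i
    simp only [Matrix.mulVec, dotProduct, Fin.sum_univ_castSucc, Matrix.map_apply, hBc, hBl]
    push_cast
    ring
  have hAxi : ∀ i, (∑ j : Fin t, (A i j : ℚ) * (x j : ℚ)) = b i := by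
    intro i
    have := congrFun hAx i
    simp only [Matrix.mulVec, dotProduct] at this
    exact_mod_cast this
  have hM' : ∀ (ρ : Fin r → Fin s) (σ : Fin r → Fin (t + 1)),
      Function.Injective ρ → Function.Injective σ →
      ((B.submatrix ρ σ).det).natAbs ≤ M := by
    intro ρ σ hρ hσ
    have h1 : (B.submatrix ρ σ).det = (∏ k, d (σ k)) * (Aext.submatrix ρ σ).det := by
      rw [← Matrix.det_mul_row]; rfl
    have h2 : (∏ k, d (σ k)).natAbs = 1 := by
      rw [← Int.natAbsHom_apply, map_prod]
      apply Finset.prod_eq_one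
      intro k _
      simp only [Int.natAbsHom_apply, d]
      split_ifs <;> rfl
    rw [h1, Int.natAbs_mul, h2, one_mul]
    exact hM ρ σ hρ hσ
  have hr' : r = (B.map ((↑) : ℤ → ℚ)).rank := by
    rw [hr]
    apply le_antisymm
    · have : A.map ((↑) : ℤ → ℚ) = (B.map ((↑) : ℤ → ℚ)).submatrix id Fin.castSucc := by
        ext i j; simp [hBc]
      rw [this]
      exact Matrix.rank_submatrix_le _ _ _
    · have : B.map ((↑) : ℤ → ℚ) = A.map ((↑) : ℤ → ℚ) *
          (Matrix.of fun i j => Fin.lastCases (motive := fun _ => ℚ) (-(x i : ℚ))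
            (fun k => if i = k then 1 else 0) j) := by
        ext i j
        rw [Matrix.mul_apply]
        refine Fin.lastCases ?_ (fun j => ?_) j
        · simp [hBl, ← hAxi]
        · simp [hBc]
      rw [this]
      exact Matrix.rank_mul_le_left _ _
  let z : Fin (t + 1) → ℚ := Fin.snoc (fun j => (x j : ℚ)) 1
  have hz : ∀ j, 0 ≤ z j := by
    intro j
    refine Fin.lastCases ?_ (fun j => ?_) j <;> simp [z]
  have hBz : Matrix.mulVec (B.map ((↑) : ℤ → ℚ)) z = 0 := by
    ext i
    rw [hBmul]
    simp [z, hAxi]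
  obtain ⟨v, l, hl, hlv, hv, hvM, hdec⟩ := decompose B hr' hM' (t + 1) z hz hBz
    ((Finset.card_le_univ _).trans (by simp))
  have hterm : ∀ i j, l i * (v i j : ℚ) ≤ z j := by
    intro i j
    rw [hdec j]
    exact Finset.single_le_sum (f := fun i => l i * (v i j : ℚ))
      (fun i _ => mul_nonneg (hl i) (Nat.cast_nonneg _)) (Finset.mem_univ i)
  apply Finset.sup_le
  intro j _
  by_cases hall : ∀ i, l i ≤ 1
  · have h1 : (x j : ℚ) ≤ ∑ i : Fin (t + 1), (M : ℚ) := by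
      have : (x j : ℚ) = z j.castSucc := by simp [z]
      rw [this, hdec]
      apply Finset.sum_le_sum
      intro i _
      have h2 : (v i j.castSucc : ℚ) ≤ M := by exact_mod_cast hvM i j.castSucc
      calc l i * (v i j.castSucc : ℚ) ≤ 1 * (v i j.castSucc : ℚ) :=
            mul_le_mul_of_nonneg_right (hall i) (Nat.cast_nonneg _)
        _ ≤ M := by rwa [one_mul]
    rw [Finset.sum_const, Finset.card_univ, Fintype.card_fin, nsmul_eq_mul] at h1
    exact_mod_cast h1
  · push Not at hall
    obtain ⟨i, hi⟩ := hall
    have hlast : v i (Fin.last t) = 0 := by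
      by_contra h
      have h1 : (1 : ℚ) ≤ v i (Fin.last t) := by exact_mod_cast Nat.pos_of_ne_zero h
      have h2 := hterm i (Fin.last t)
      have h3 : z (Fin.last t) = 1 := by simp [z]
      rw [h3] at h2
      nlinarith
    have hle : ∀ k : Fin t, v i k.castSucc ≤ x k := by
      intro k
      have h2 := hterm i k.castSucc
      have h3 : z k.castSucc = x k := by simp [z]
      rw [h3] at h2
      have h4 : (0 : ℚ) ≤ v i k.castSucc := Nat.cast_nonneg _
      have : (v i k.castSucc : ℚ) ≤ x k := by nlinarith
      exact_mod_cast this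
    let y : Fin t → ℕ := fun k => x k - v i k.castSucc
    have hyx : y ≤ x := fun k => Nat.sub_le _ _
    have hAy : A.mulVec (fun k => (y k : ℤ)) = b := by
      ext a
      have h1 := congrFun (hv i) a
      rw [hBmul] at h1
      simp only [hlast, Nat.cast_zero, mul_zero, sub_zero, Pi.zero_apply] at h1
      have h2 : ∑ k, (A a k : ℚ) * (y k : ℚ) = b a := by
        rw [← hAxi a, ← sub_zero (∑ k, (A a k : ℚ) * (x k : ℚ)), ← h1, ← Finset.sum_sub_distrib]
        apply Finset.sum_congr rfl
        intro k _
        simp only [y]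
        rw [Nat.cast_sub (hle k)]
        ring
      simp only [Matrix.mulVec, dotProduct]
      exact_mod_cast h2
    have hy0 : y = 0 := by
      by_contra hy
      have hyeq := hmin y ⟨hy, hAy⟩ hyx
      apply hlv i (by linarith)
      ext k
      refine Fin.lastCases ?_ (fun k => ?_) k
      · simpa using hlast
      · have h1 := congrFun hyeq k
        have h2 := hle k
        simp only [y] at h1
        simp only [Pi.zero_apply]
        omega
    have h1 := congrFun hy0 j
    have h2 := hvM i j.castSucc
    simp only [y, Pi.zero_apply] at h1
    have h3 : x j ≤ M := by omega
    nlinarith [Nat.zero_le (t * M)]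
end

section
/- Let k ≥ 1, and let ⋃_{i ∈ I} L(c_i, P_i) and ⋃_{j ∈ J} L(c_j, P_j) be semilinear subsets of ℕ^k, where I and J are disjoint finite index sets. Set n = max_{i ∈ I ∪ J} ‖P_i‖, m = max_{i ∈ I ∪ J} |P_i|, and ℓ = max_{i ∈ I ∪ J} ‖c_i‖. Then for every pair (i,j) ∈ I × J there exist finite sets P_{i,j}, C_{i,j} ⊆ ℕ^k with ‖P_{i,j}‖ ≤ 3 m² k^{k/2} n^{k+1} and ‖C_{i,j}‖ ≤ (3 m² k^{k/2} n^{k+1} + 1)·ℓ such that (⋃_{i ∈ I} L(c_i, P_i)) ∩ (⋃_{j ∈ J} L(c_j, P_j)) = ⋃_{(i,j) ∈ I × J} L(C_{i,j}, P_{i,j}). -/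
/-- Maximum norm of a vector in `ℕ^k`. -/
def vnorm {k : ℕ} (x : Fin k → ℕ) : ℕ := Finset.univ.sup x

/-- Maximum norm of a finite set of vectors in `ℕ^k` (`0` for the empty set). -/
def snorm {k : ℕ} (P : Finset (Fin k → ℕ)) : ℕ := P.sup vnorm

/-- The set `L(C,P) = { c + ∑_{x ∈ P} λ_x • x : c ∈ C, λ_x ∈ ℕ }`. -/
def LSet {k : ℕ} (C P : Finset (Fin k → ℕ)) : Set (Fin k → ℕ) :=
  {v | ∃ c ∈ C, ∃ lam : (Fin k → ℕ) → ℕ, v = c + ∑ x ∈ P, lam x • x}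

/-- The linear set `L(c,P)` with a single constant vector `c`. -/
def LSet1 {k : ℕ} (c : Fin k → ℕ) (P : Finset (Fin k → ℕ)) : Set (Fin k → ℕ) :=
  LSet {c} P

/-- A finite set of vectors of `ℕ^k` is linearly independent if its elements,
viewed as vectors in `ℚ^k`, are linearly independent. -/
def LinIndep {k : ℕ} (P : Finset (Fin k → ℕ)) : Prop :=
  LinearIndependent ℚ (fun x : P => fun i => ((x : Fin k → ℕ) i : ℚ))


theorem hadamard_fin (r : ℕ) (A : Matrix (Fin r) (Fin r) ℝ) (w : Fin r → ℝ)
    (hA : ∀ i j, |A i j| ≤ w j) : |A.det| ≤ (√(r : ℝ)) ^ r * ∏ j, w j := by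
  have : Fact (Module.finrank ℝ (EuclideanSpace ℝ (Fin r)) = r) := ⟨by simp⟩
  let b := EuclideanSpace.basisFun (Fin r) ℝ
  let o := b.toBasis.orientation
  let v : Fin r → EuclideanSpace ℝ (Fin r) := fun j => WithLp.toLp 2 (fun i => A i j)
  have h1 := o.abs_volumeForm_apply_le v
  rw [o.volumeForm_robust' b] at h1
  have h2 : b.toBasis.det v = A.det := by
    rw [Module.Basis.det_apply]
    congr 1
  rw [h2] at h1
  refine h1.trans ?_
  have h3 : (√(r : ℝ)) ^ r * ∏ j, w j = ∏ j : Fin r, (√(r : ℝ) * w j) := by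
    rw [Finset.prod_mul_distrib]; simp
  rw [h3]
  apply Finset.prod_le_prod
  · intros; positivity
  intro j _
  have hw : 0 ≤ w j := (abs_nonneg _).trans (hA j j)
  rw [EuclideanSpace.norm_eq, ← Real.sqrt_sq hw, ← Real.sqrt_mul (by positivity)]
  apply Real.sqrt_le_sqrt
  calc ∑ i, ‖v j i‖ ^ 2 ≤ ∑ i : Fin r, (w j) ^ 2 := by
        apply Finset.sum_le_sum
        intro i _
        have := hA i j
        simp only [v, Real.norm_eq_abs]
        gcongr
    _ = _ := by simp

theorem hadamard_gen {ι : Type*} [Fintype ι] [DecidableEq ι] (A : Matrix ι ι ℝ) (w : ι → ℝ)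
    (hA : ∀ i j, |A i j| ≤ w j) :
    |A.det| ≤ (√(Fintype.card ι : ℝ)) ^ (Fintype.card ι) * ∏ j, w j := by
  let e := Fintype.equivFin ι
  have h := hadamard_fin _ (Matrix.reindex e e A) (w ∘ e.symm) (fun i j => hA _ _)
  rw [Matrix.det_reindex_self] at h
  have : ∏ j, (w ∘ e.symm) j = ∏ j, w j := Equiv.prod_comp e.symm w
  rwa [this] at h

theorem exists_rows_s3 {ι : Type*} [Fintype ι] [DecidableEq ι] {k : ℕ} (v : ι → Fin k → ℝ)
    (hv : LinearIndependent ℝ v) :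
    ∃ e : ι → Fin k, (Matrix.of fun i j => v j (e i)).det ≠ 0 := by
  let A : Matrix (Fin k) ι ℝ := Matrix.of fun i j => v j i
  have hr : A.rank = Fintype.card ι := by
    rw [← Matrix.rank_transpose]
    exact LinearIndependent.rank_matrix (M := A.transpose) hv
  obtain ⟨κ, a, ha, hsp, hli⟩ := exists_linearIndependent' ℝ A.row
  have : Finite κ := Finite.of_injective a ha
  have : Fintype κ := Fintype.ofFinite κ
  have hc : Fintype.card κ = Fintype.card ι := by
    rw [linearIndependent_iff_card_eq_finrank_span.mp hli, Set.finrank, hsp,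
      ← Matrix.rank_eq_finrank_span_row, hr]
  let f : ι ≃ κ := (Fintype.equivOfCardEq hc).symm
  refine ⟨a ∘ f, ?_⟩
  have h2 : LinearIndependent ℝ (Matrix.of fun i j => v j ((a ∘ f) i)).row :=
    hli.comp f f.injective
  rw [Matrix.linearIndependent_rows_iff_isUnit, Matrix.isUnit_iff_isUnit_det] at h2
  exact h2.ne_zero

/-- Maximal step along `-y` inside the nonnegative orthant. -/
theorem step_lemma {κ : Type*} [Fintype κ] (x y : κ → ℝ) (hx : ∀ j, 0 ≤ x j)
    (hs : ∀ j, x j = 0 → y j = 0) (hy : ∃ j, 0 < y j) :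
    ∃ t : ℝ, 0 < t ∧ (∀ j, 0 ≤ x j - t * y j) ∧ ∃ j, x j ≠ 0 ∧ x j - t * y j = 0 := by
  classical
  obtain ⟨j1, hj1⟩ := hy
  obtain ⟨j, hj, hmin⟩ := Finset.exists_min_image (Finset.univ.filter fun j => 0 < y j)
    (fun j => x j / y j) ⟨j1, by simp [hj1]⟩
  simp only [Finset.mem_filter, Finset.mem_univ, true_and] at hj hmin
  have hxj : x j ≠ 0 := fun h => by rw [hs j h] at hj; exact lt_irrefl _ hj
  have hxj' : 0 < x j := lt_of_le_of_ne (hx j) (Ne.symm hxj)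
  have ht : 0 < x j / y j := by positivity
  refine ⟨x j / y j, ht, ?_, j, hxj, by field_simp; simp⟩
  intro i
  by_cases hi : 0 < y i
  · have := hmin i hi
    rw [le_div_iff₀ hi] at this
    linarith
  · have : x j / y j * y i ≤ 0 := mul_nonpos_of_nonneg_of_nonpos ht.le (not_lt.mp hi)
    linarith [hx i]

/-- Support-minimal nonnegative kernel vectors are multiples of small integer vectors. -/
theorem min_ray {κ : Type*} [Fintype κ] [DecidableEq κ] {k : ℕ} (col : κ → Fin k → ℤ)
    (w : κ → ℝ) (hw : ∀ j i, |(col j i : ℝ)| ≤ w j)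
    (x : κ → ℝ) (hx : ∀ j, 0 ≤ x j) (hk : ∀ i, ∑ j, x j * (col j i : ℝ) = 0)
    (j0 : κ) (hj0 : x j0 ≠ 0)
    (hmin : ∀ z : κ → ℝ, (∀ j, 0 ≤ z j) → (∀ i, ∑ j, z j * (col j i : ℝ) = 0) →
      (∀ j, x j = 0 → z j = 0) → z ≠ 0 → ∀ j, z j = 0 → x j = 0)
    (S : Finset κ) (hS : ∀ j, j ∈ S ↔ x j ≠ 0) :
    ∃ (r : κ → ℕ) (β : ℝ) (s : ℕ), 0 < β ∧ (∀ j, x j = β * r j) ∧ s ≤ k ∧ s + 1 = S.card ∧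
      ∀ j ∈ S, (r j : ℝ) ≤ (√(s : ℝ)) ^ s * ∏ i ∈ S.erase j, w i := by
  have hx0 : 0 < x j0 := lt_of_le_of_ne (hx j0) (Ne.symm hj0)
  have hj0S : j0 ∈ S := (hS j0).2 hj0
  -- no kernel vectors supported off j0
  have key : ∀ y : κ → ℝ, (∀ j, x j = 0 → y j = 0) → y j0 = 0 →
      (∀ i, ∑ j, y j * (col j i : ℝ) = 0) → ∀ j, y j ≤ 0 := by
    intro y hy hy0 hyk
    by_contra! hc
    obtain ⟨t, ht, hnn, j, hj, hjz⟩ := step_lemma x y hx hy hc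
    refine hj (hmin (fun j => x j - t * y j) hnn ?_ ?_ ?_ j hjz)
    · intro i
      simp only [sub_mul, mul_assoc, Finset.sum_sub_distrib, ← Finset.mul_sum, hk, hyk]
      simp
    · intro j h
      simp [h, hy j h]
    · intro h
      have := congrFun h j0
      simp [hy0] at this
      exact hj0 this
  let ι := ↥(S.erase j0)
  let v : ι → Fin k → ℝ := fun j i => (col j i : ℝ)
  have hsum : ∀ (f : κ → ℝ), (∀ j, x j = 0 → f j = 0) → ∑ j, f j = f j0 + ∑ j : ι, f j := by
    intro f hf
    rw [Finset.sum_coe_sort (S.erase j0) f, Finset.add_sum_erase S f hj0S]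
    symm
    apply Finset.sum_subset (Finset.subset_univ _)
    intro j _ hj
    apply hf
    by_contra h
    exact hj ((hS j).2 h)
  have hli : LinearIndependent ℝ v := by
    rw [Fintype.linearIndependent_iff]
    intro g hg
    let y : κ → ℝ := fun j => if h : j ∈ S.erase j0 then g ⟨j, h⟩ else 0
    have hy0 : y j0 = 0 := by simp [y]
    have hyS : ∀ j, x j = 0 → y j = 0 := by
      intro j hj
      have : j ∉ S := by rw [hS]; simpa using hj
      simp [y, this]
    have hyk : ∀ i, ∑ j, y j * (col j i : ℝ) = 0 := by
      intro i
      rw [hsum (fun j => y j * (col j i : ℝ)) (fun j hj => by simp [hyS j hj])]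
      have := congrFun hg i
      simp only [Finset.sum_apply, Pi.smul_apply, smul_eq_mul, Pi.zero_apply] at this
      rw [hy0, zero_mul, zero_add, ← this]
      apply Finset.sum_congr rfl
      rintro ⟨j, hj⟩ _
      simp only [y, dif_pos hj]; rfl
    have h1 := key y hyS hy0 hyk
    have h2 := key (fun j => - y j) (fun j h => by simp [hyS j h]) (by simp [hy0])
      (fun i => by simp [hyk])
    rintro ⟨j, hj⟩
    have h3 := h1 j
    have h4 := h2 j
    simp only [y, dif_pos hj] at h3 h4
    linarith
  have hcard : Fintype.card ι ≤ k := by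
    simpa using hli.fintype_card_le_finrank
  have hcard2 : Fintype.card ι + 1 = S.card := by
    rw [Fintype.card_coe, Finset.card_erase_add_one hj0S]
  obtain ⟨e, he⟩ := exists_rows_s3 v hli
  let M : Matrix ι ι ℤ := Matrix.of fun i j => col j (e i)
  let c0 : ι → ℤ := fun i => col j0 (e i)
  let R : Matrix ι ι ℝ := M.map (Int.cast : ℤ → ℝ)
  let d0 : ι → ℝ := fun i => (c0 i : ℝ)
  have hR : R.det ≠ 0 := he
  have hMR : ((M.det : ℤ) : ℝ) = R.det := Int.cast_det M
  have hupd : ∀ j, (((M.updateCol j c0).det : ℤ) : ℝ) = (R.updateCol j d0).det := by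
    intro j
    rw [Int.cast_det, Matrix.map_updateCol]
    rfl
  let u : ι → ℝ := fun j => x j
  have hMu : R.mulVec u = -(x j0) • d0 := by
    ext i
    have := hk (e i)
    rw [hsum (fun j => x j * (col j (e i) : ℝ)) (fun j hj => by simp [hj])] at this
    simp only [Matrix.mulVec, dotProduct, Pi.smul_apply, smul_eq_mul]
    have h2 : ∑ j, R i j * u j = ∑ j : ι, x j * (col j (e i) : ℝ) :=
      Finset.sum_congr rfl fun j _ => mul_comm _ _
    rw [h2]
    simp only [d0, c0]
    linarith
  have hcr : ∀ j : ι, R.det * x j = -(x j0) * (R.updateCol j d0).det := by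
    intro j
    have h1 : R.cramer (R.mulVec u) = R.det • u := by
      rw [Matrix.cramer_eq_adjugate_mulVec, Matrix.mulVec_mulVec, Matrix.adjugate_mul,
        Matrix.smul_mulVec, Matrix.one_mulVec]
    rw [hMu, map_smul] at h1
    have h2 := congrFun h1 j
    simp only [Pi.smul_apply, smul_eq_mul, Matrix.cramer_apply] at h2
    exact h2.symm
  have hcr' : ∀ j : ι, x j = x j0 / |R.det| * |(R.updateCol j d0).det| := by
    intro j
    have h := congrArg abs (hcr j)
    rw [abs_mul, abs_mul, abs_neg, abs_of_nonneg (hx j), abs_of_nonneg hx0.le] at h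
    have : |R.det| ≠ 0 := by simpa using hR
    field_simp
    linarith
  let r : κ → ℕ := fun j => if h : j ∈ S.erase j0 then ((M.updateCol ⟨j, h⟩ c0).det).natAbs
    else if j = j0 then M.det.natAbs else 0
  have hrj : ∀ j (h : j ∈ S.erase j0), (r j : ℝ) = |(R.updateCol ⟨j, h⟩ d0).det| := by
    intro j h
    simp only [r, dif_pos h]
    rw [Nat.cast_natAbs, Int.cast_abs, hupd]
  have hr0 : (r j0 : ℝ) = |R.det| := by
    have : r j0 = M.det.natAbs := by simp [r]
    rw [this, Nat.cast_natAbs, Int.cast_abs, hMR]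
  have hβ : 0 < x j0 / |R.det| := by positivity
  refine ⟨r, x j0 / |R.det|, Fintype.card ι, hβ, ?_, hcard, hcard2, ?_⟩
  · intro j
    by_cases h : j ∈ S.erase j0
    · rw [hrj j h]; exact hcr' ⟨j, h⟩
    · by_cases h' : j = j0
      · subst h'
        rw [hr0]
        have : |R.det| ≠ 0 := by simpa using hR
        field_simp
      · have : x j = 0 := by
          by_contra hh
          exact h (Finset.mem_erase.2 ⟨h', (hS j).2 hh⟩)
        have hr : r j = 0 := by simp only [r, dif_neg h, if_neg h']
        simp [this, hr]
  · intro j hj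
    by_cases h : j = j0
    · subst h
      rw [hr0]
      refine (hadamard_gen R (fun i => w i) (fun i l => hw _ _)).trans ?_
      rw [Finset.prod_coe_sort (S.erase j) w]
    · have h' : j ∈ S.erase j0 := Finset.mem_erase.2 ⟨h, hj⟩
      rw [hrj j h']
      let w' : ι → ℝ := Function.update (fun i : ι => w i) ⟨j, h'⟩ (w j0)
      refine (hadamard_gen _ w' ?_).trans ?_
      · intro i l
        by_cases hl : l = ⟨j, h'⟩
        · subst hl
          simp only [Matrix.updateCol_self, w', Function.update_self]
          exact hw _ _
        · simp only [w', Matrix.updateCol_ne hl, Function.update_of_ne hl]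
          exact hw _ _
      · apply le_of_eq
        congr 1
        have e1 : ∏ l, w' l = w j0 * ∏ l ∈ Finset.univ.erase (⟨j, h'⟩ : ι), w l := by
          rw [← Finset.mul_prod_erase Finset.univ w' (Finset.mem_univ ⟨j, h'⟩)]
          congr 1
          · simp [w']
          · apply Finset.prod_congr rfl
            intro l hl
            simp only [w']
            rw [Function.update_of_ne (Finset.ne_of_mem_erase hl)]
        have e2 : ∏ l ∈ Finset.univ.erase (⟨j, h'⟩ : ι), w l = ∏ l ∈ (S.erase j0).erase j, w l := by
          refine Finset.prod_bij (fun l _ => (l : κ)) ?_ ?_ ?_ ?_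
          · rintro ⟨l, hl⟩ hl2
            simp only [Finset.mem_erase, Finset.mem_univ, and_true, ne_eq, Subtype.mk.injEq] at hl2 hl ⊢
            exact ⟨hl2, hl⟩
          · rintro a _ b _ hab
            exact Subtype.ext hab
          · intro b hb
            have hb' := Finset.mem_erase.1 hb
            exact ⟨⟨b, hb'.2⟩, by simp [hb'.1], rfl⟩
          · intros; rfl
        rw [e1, e2, Finset.erase_right_comm]
        exact Finset.mul_prod_erase _ _ (Finset.mem_erase.2 ⟨Ne.symm h, hj0S⟩)

/-- Small integer rays of the cone of nonnegative kernel vectors. -/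
def GoodRay {κ : Type*} [Fintype κ] [DecidableEq κ] {k : ℕ} (col : κ → Fin k → ℤ)
    (w : κ → ℝ) (r : κ → ℕ) : Prop :=
  (∀ i, ∑ j, (r j : ℝ) * (col j i : ℝ) = 0) ∧
  ∃ (S : Finset κ) (s : ℕ), (∀ j, j ∈ S ↔ r j ≠ 0) ∧ s ≤ k ∧ s + 1 = S.card ∧
    ∀ j ∈ S, (r j : ℝ) ≤ (√(s : ℝ)) ^ s * ∏ i ∈ S.erase j, w i

theorem exists_ray {κ : Type*} [Fintype κ] [DecidableEq κ] {k : ℕ} (col : κ → Fin k → ℤ)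
    (w : κ → ℝ) (hw : ∀ j i, |(col j i : ℝ)| ≤ w j)
    (x : κ → ℝ) (hx : ∀ j, 0 ≤ x j) (hk : ∀ i, ∑ j, x j * (col j i : ℝ) = 0) (hne : x ≠ 0) :
    ∃ r : κ → ℕ, GoodRay col w r ∧ (∀ j, x j = 0 → r j = 0) ∧ ∃ j, 0 < r j := by
  classical
  let T : Set (κ → ℝ) := {z | (∀ j, 0 ≤ z j) ∧ (∀ i, ∑ j, z j * (col j i : ℝ) = 0) ∧
      (∀ j, x j = 0 → z j = 0) ∧ z ≠ 0}
  let f : (κ → ℝ) → ℕ := fun z => (Finset.univ.filter fun j => z j ≠ 0).card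
  have hT : T.Nonempty := ⟨x, hx, hk, fun _ h => h, hne⟩
  obtain ⟨z, ⟨hz0, hzk, hzx, hzne⟩, hzmin⟩ :=
    (WellFounded.has_min (InvImage.wf f Nat.lt_wfRel.wf) T hT)
  obtain ⟨j0, hj0⟩ : ∃ j, z j ≠ 0 := by
    by_contra! h
    exact hzne (funext h)
  obtain ⟨r, β, s, hβ, hr, hs, hcard, hb⟩ := min_ray col w hw z hz0 hzk j0 hj0 (by
    intro y hy0 hyk hyz hyne j hyj
    by_contra hzj
    refine hzmin y ⟨hy0, hyk, fun j h => hyz j (hzx j h), hyne⟩ ?_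
    apply Finset.card_lt_card
    rw [Finset.ssubset_iff_of_subset]
    · exact ⟨j, by simp [hzj], by simp [hyj]⟩
    · intro l
      simp only [Finset.mem_filter, Finset.mem_univ, true_and]
      exact fun h h' => h (hyz l h')) (Finset.univ.filter fun j => z j ≠ 0) (by simp)
  have hr0 : ∀ j, z j = 0 ↔ r j = 0 := by
    intro j
    rw [hr j]
    simp [hβ.ne']
  refine ⟨r, ⟨?_, _, s, ?_, hs, hcard, hb⟩, ?_, j0, ?_⟩
  · intro i
    have h1 := hzk i
    simp only [hr, mul_assoc, ← Finset.mul_sum] at h1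
    exact (mul_eq_zero.1 h1).resolve_left hβ.ne'
  · intro j
    simp [hr0]
  · intro j h
    exact (hr0 j).1 (hzx j h)
  · exact Nat.pos_of_ne_zero fun h => hj0 ((hr0 j0).2 h)

theorem decomp {κ : Type*} [Fintype κ] [DecidableEq κ] {k : ℕ} (col : κ → Fin k → ℤ)
    (w : κ → ℝ) (hw : ∀ j i, |(col j i : ℝ)| ≤ w j) (d : ℕ) :
    ∀ (x : κ → ℝ), (∀ j, 0 ≤ x j) → (∀ i, ∑ j, x j * (col j i : ℝ) = 0) →
    (∃ S : Finset κ, S.card ≤ d ∧ ∀ j, j ∉ S → x j = 0) →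
    ∃ (q : ℕ) (r : Fin q → κ → ℕ) (α : Fin q → ℝ), q ≤ d ∧ (∀ t, GoodRay col w (r t)) ∧
      (∀ t, 0 ≤ α t) ∧ ∀ j, x j = ∑ t, α t * r t j := by
  induction d with
  | zero =>
    rintro x hx hk ⟨S, hS, hS2⟩
    have : S = ∅ := Finset.card_eq_zero.1 (by omega)
    subst this
    exact ⟨0, fun _ => 0, fun _ => 0, le_rfl, fun t => t.elim0, fun t => t.elim0,
      fun j => by simp [hS2 j (by simp)]⟩
  | succ d ih =>
    rintro x hx hk ⟨S, hS, hS2⟩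
    by_cases hne : x = 0
    · subst hne
      exact ⟨0, fun _ => 0, fun _ => 0, by omega, fun t => t.elim0, fun t => t.elim0,
        fun j => by simp⟩
    obtain ⟨r, hr, hrx, j1, hj1⟩ := exists_ray col w hw x hx hk hne
    obtain ⟨t, ht, hnn, j, hj, hjz⟩ := step_lemma x (fun j => (r j : ℝ)) hx
      (fun j h => by simp [hrx j h]) ⟨j1, by exact_mod_cast hj1⟩
    obtain ⟨q, r', α, hq, h1, h2, h3⟩ := ih (fun j => x j - t * r j) hnn (by
      intro i
      simp only [sub_mul, mul_assoc, Finset.sum_sub_distrib, ← Finset.mul_sum, hk, hr.1 i]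
      simp) ⟨S.erase j, by
        have hjS : j ∈ S := by
          by_contra h
          exact hj (hS2 j h)
        rw [Finset.card_erase_of_mem hjS]; omega, by
        intro l hl
        by_cases hlj : l = j
        · subst hlj; exact hjz
        · have : l ∉ S := fun h => hl (Finset.mem_erase.2 ⟨hlj, h⟩)
          simp [hS2 l this, hrx l (hS2 l this)]⟩
    refine ⟨q + 1, Fin.cons r r', Fin.cons t α, by omega, ?_, ?_, ?_⟩
    · intro t
      refine Fin.cases ?_ ?_ t
      · simpa using hr
      · intro t; simpa using h1 t
    · intro t'
      refine Fin.cases ?_ ?_ t'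
      · simpa using ht.le
      · intro t; simpa using h2 t
    · intro j
      rw [Fin.sum_univ_succ]
      simp only [Fin.cons_zero, Fin.cons_succ, ← h3 j]
      ring

theorem ray_bounds {κ : Type*} [Fintype κ] [DecidableEq κ] {k n ℓ : ℕ} (hn : 1 ≤ n)
    (col : Option κ → Fin k → ℤ) (w : Option κ → ℝ) (hw0 : w none = ℓ) (hw1 : ∀ j, w (some j) = n)
    (r : Option κ → ℕ) (hr : GoodRay col w r) :
    (r none = 0 → ∀ j, (r (some j) : ℝ) ≤ (√(k : ℝ)) ^ k * n ^ k) ∧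
    (r none ≠ 0 → ∀ j, (r (some j) : ℝ) ≤ (√(k : ℝ)) ^ k * n ^ k * ℓ) := by
  obtain ⟨-, S, s, hS, hs, hcard, hb⟩ := hr
  have hn' : (1 : ℝ) ≤ n := by exact_mod_cast hn
  have hsq : (√(s : ℝ)) ^ s ≤ (√(k : ℝ)) ^ k := by
    rcases Nat.eq_zero_or_pos k with h | h
    · subst h
      have : s = 0 := by omega
      subst this; simp
    · have h1 : (1 : ℝ) ≤ √(k : ℝ) := Real.one_le_sqrt.2 (by exact_mod_cast h)
      calc (√(s : ℝ)) ^ s ≤ (√(k : ℝ)) ^ s := by gcongr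
        _ ≤ _ := pow_le_pow_right₀ h1 hs
  have hprod : ∀ U : Finset (Option κ), none ∉ U → ∏ i ∈ U, w i = (n : ℝ) ^ U.card := by
    intro U hU
    rw [Finset.prod_congr rfl (g := fun _ => (n : ℝ)), Finset.prod_const]
    intro i hi
    cases i with
    | none => exact absurd hi hU
    | some j => exact hw1 j
  constructor
  · intro h0 j
    by_cases hj : some j ∈ S
    · refine (hb _ hj).trans ?_
      rw [hprod _ (by simp [hS, h0]), Finset.card_erase_of_mem hj, ← hcard, Nat.add_sub_cancel]
      have : (n : ℝ) ^ s ≤ n ^ k := pow_le_pow_right₀ hn' hs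
      gcongr
    · have : r (some j) = 0 := by simpa [hS] using hj
      rw [this]; push_cast; positivity
  · intro h0 j
    by_cases hj : some j ∈ S
    · refine (hb _ hj).trans ?_
      have hnone : none ∈ S.erase (some j) := by simp [hS, h0]
      rw [← Finset.mul_prod_erase _ _ hnone, hprod _ (by simp), hw0,
        Finset.card_erase_of_mem hnone, Finset.card_erase_of_mem hj, ← hcard, Nat.add_sub_cancel,
        mul_assoc, mul_comm ((n : ℝ) ^ k)]
      have : (n : ℝ) ^ (s - 1) ≤ n ^ k := pow_le_pow_right₀ hn' (by omega)
      gcongr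
    · have : r (some j) = 0 := by simpa [hS] using hj
      rw [this]; push_cast; positivity

theorem core {κ : Type*} [Fintype κ] [DecidableEq κ] {k n ℓ : ℕ} (hn : 1 ≤ n)
    (col : κ → Fin k → ℤ) (b : Fin k → ℤ) (hcol : ∀ j i, |col j i| ≤ n) (hb : ∀ i, |b i| ≤ ℓ)
    (ε : ℕ) (hε : ε ≤ 1) (x : κ → ℕ) (hx : ∀ i, ∑ j, (x j : ℤ) * col j i = ε * b i) :
    ∃ (q : ℕ) (r : Fin q → κ → ℕ) (a : Fin q → ℕ) (y : κ → ℕ),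
      (∀ j, x j = y j + ∑ t, a t * r t j) ∧
      (∀ t i, ∑ j, (r t j : ℤ) * col j i = 0) ∧
      (∀ t j, (r t j : ℝ) ≤ (√(k : ℝ)) ^ k * n ^ k) ∧
      (∀ j, (y j : ℝ) ≤ Fintype.card κ * ((√(k : ℝ)) ^ k * n ^ k)
        + ε * ((√(k : ℝ)) ^ k * n ^ k * ℓ)) := by
  classical
  let col' : Option κ → Fin k → ℤ := fun j => j.elim (-b) col
  let w : Option κ → ℝ := fun j => j.elim (ℓ : ℝ) (fun _ => (n : ℝ))
  let X : Option κ → ℕ := fun j => j.elim ε x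
  have hw : ∀ j i, |(col' j i : ℝ)| ≤ w j := by
    intro j i
    cases j with
    | none =>
      simp only [col', w, Option.elim, Pi.neg_apply, Int.cast_neg, abs_neg]
      exact_mod_cast hb i
    | some j =>
      simp only [col', w, Option.elim]
      exact_mod_cast hcol j i
  have hX : ∀ i, ∑ j, (X j : ℝ) * (col' j i : ℝ) = 0 := by
    intro i
    rw [Fintype.sum_option]
    simp only [X, col', Option.elim, Pi.neg_apply, Int.cast_neg]
    have := congrArg (Int.cast : ℤ → ℝ) (hx i)
    push_cast at this
    rw [this]; ring
  obtain ⟨q, r, α, hq, hr, hα, hdec⟩ := decomp col' w hw (Fintype.card κ + ε) (fun j => (X j : ℝ))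
    (fun j => by positivity) hX (by
      rcases Nat.eq_zero_or_pos ε with h | h
      · refine ⟨Finset.univ.erase none, ?_, ?_⟩
        · rw [Finset.card_erase_of_mem (Finset.mem_univ _)]; simp
        · intro j hj
          have : j = none := by simpa using hj
          subst this
          simp [X, h]
      · refine ⟨Finset.univ, ?_, fun j hj => absurd (Finset.mem_univ j) hj⟩
        simp; omega)
  set D : ℝ := (√(k : ℝ)) ^ k * n ^ k with hD
  have hD0 : 0 ≤ D := by positivity
  have hbd := fun t => ray_bounds (ℓ := ℓ) hn col' w rfl (fun _ => rfl) (r t) (hr t)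
  let T0 : Finset (Fin q) := Finset.univ.filter fun t => r t none = 0
  have hnone : (ε : ℝ) = ∑ t, α t * r t none := hdec none
  have hT0 : T0.card ≤ Fintype.card κ := by
    rcases Nat.eq_zero_or_pos ε with h | h
    · have : T0.card ≤ q := (Finset.card_le_univ T0).trans (by simp)
      omega
    · have : T0 ≠ Finset.univ := by
        intro hT
        have h0 : ∑ t, α t * (r t none : ℝ) = 0 := by
          apply Finset.sum_eq_zero
          intro t _
          have : t ∈ T0 := hT ▸ Finset.mem_univ t
          simp only [T0, Finset.mem_filter, Finset.mem_univ, true_and] at this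
          simp [this]
        rw [h0] at hnone
        have : ε = 0 := by exact_mod_cast hnone
        omega
      have h2 := Finset.card_lt_card (Finset.ssubset_univ_iff.2 this)
      simp only [Finset.card_univ, Fintype.card_fin] at h2
      omega
  let a : Fin q → ℕ := fun t => if r t none = 0 then ⌊α t⌋₊ else 0
  let r' : Fin q → κ → ℕ := fun t j => if r t none = 0 then r t (some j) else 0
  have har : ∀ t j, (a t : ℝ) * r' t j ≤ α t * r t (some j) := by
    intro t j
    by_cases h : r t none = 0
    · simp only [a, r', if_pos h]
      have := Nat.floor_le (hα t)
      gcongr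
    · simp only [a, r', if_neg h]
      have := hα t
      simp; positivity
  have hle : ∀ j, ∑ t, a t * r' t j ≤ x j := by
    intro j
    have h1 : ((∑ t, a t * r' t j : ℕ) : ℝ) ≤ x j := by
      have : (x j : ℝ) = _ := hdec (some j)
      rw [this]
      push_cast
      exact Finset.sum_le_sum fun t _ => har t j
    exact_mod_cast h1
  refine ⟨q, r', a, fun j => x j - ∑ t, a t * r' t j, ?_, ?_, ?_, ?_⟩
  · intro j
    exact (Nat.sub_add_cancel (hle j)).symm
  · intro t i
    by_cases h : r t none = 0
    · simp only [r', if_pos h]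
      have h1 := (hr t).1 i
      rw [Fintype.sum_option, h] at h1
      simp only [Nat.cast_zero, zero_mul, zero_add, col', Option.elim] at h1
      exact_mod_cast h1
    · simp [r', if_neg h]
  · intro t j
    by_cases h : r t none = 0
    · simp only [r', if_pos h]
      exact (hbd t).1 h j
    · simp only [r', if_neg h]
      simpa using hD0
  · intro j
    rw [Nat.cast_sub (hle j)]
    have : (x j : ℝ) = _ := hdec (some j)
    rw [this]
    push_cast
    rw [← Finset.sum_sub_distrib]
    have hterm : ∀ t, α t * (r t (some j) : ℝ) - a t * r' t j ≤
        (if r t none = 0 then D else 0) + α t * r t none * (D * ℓ) := by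
      intro t
      by_cases h : r t none = 0
      · simp only [a, r', if_pos h, h]
        have h1 := Nat.lt_floor_add_one (α t)
        have h2 := (hbd t).1 h j
        have h3 : (0 : ℝ) ≤ r t (some j) := by positivity
        have h4 : (α t - ⌊α t⌋₊) * (r t (some j) : ℝ) ≤ 1 * r t (some j) := by
          gcongr; linarith
        push_cast
        linarith
      · simp only [a, r', if_neg h]
        have h2 := (hbd t).2 h j
        have h3 : (1 : ℝ) ≤ r t none := by exact_mod_cast Nat.pos_of_ne_zero h
        have h5 := hα t
        have h4 : α t * (r t (some j) : ℝ) ≤ α t * (1 * (D * ℓ)) := by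
          gcongr; linarith
        have h6 : α t * (1 * (D * ℓ)) ≤ α t * (r t none * (D * ℓ)) := by
          gcongr
        push_cast
        linarith
    refine (Finset.sum_le_sum fun t _ => hterm t).trans ?_
    rw [Finset.sum_add_distrib, ← Finset.sum_mul, ← hnone, ← Finset.sum_filter, Finset.sum_const,
      nsmul_eq_mul]
    have : (T0.card : ℝ) ≤ Fintype.card κ := by exact_mod_cast hT0
    gcongr

theorem mem_LSet1 {k : ℕ} (c : Fin k → ℕ) (P : Finset (Fin k → ℕ)) (v : Fin k → ℕ) :
    v ∈ LSet1 c P ↔ ∃ z : P → ℕ, v = c + ∑ p, z p • (p : Fin k → ℕ) := by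
  constructor
  · rintro ⟨c', hc', lam, rfl⟩
    rw [Finset.mem_singleton] at hc'
    subst hc'
    exact ⟨fun p => lam p, by rw [Finset.sum_coe_sort P (fun p => lam p • p)]⟩
  · rintro ⟨z, rfl⟩
    refine ⟨c, by simp, fun x => if h : x ∈ P then z ⟨x, h⟩ else 0, ?_⟩
    rw [← Finset.sum_coe_sort P]
    simp

theorem vnorm_le {k : ℕ} (x : Fin k → ℕ) (B : ℝ) (hB : 0 ≤ B) (h : ∀ i, (x i : ℝ) ≤ B) :
    (vnorm x : ℝ) ≤ B := by
  rw [← Nat.le_floor_iff hB]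
  exact Finset.sup_le fun i _ => (Nat.le_floor_iff hB).2 (h i)

theorem le_vnorm {k : ℕ} (x : Fin k → ℕ) (i : Fin k) : x i ≤ vnorm x :=
  Finset.le_sup (f := x) (Finset.mem_univ i)

theorem entry_le {k : ℕ} {P : Finset (Fin k → ℕ)} {n : ℕ} (hP : snorm P ≤ n) (p : P) (i : Fin k) :
    (p : Fin k → ℕ) i ≤ n :=
  (le_vnorm _ i).trans ((Finset.le_sup (f := vnorm) p.2).trans hP)

theorem sum_entry_le {k : ℕ} {P : Finset (Fin k → ℕ)} {n m : ℕ} (hP : snorm P ≤ n)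
    (hm : P.card ≤ m) (z : P → ℕ) (M : ℝ) (hM : 0 ≤ M) (hz : ∀ p, (z p : ℝ) ≤ M) (i : Fin k) :
    (((∑ p, z p • (p : Fin k → ℕ)) i : ℕ) : ℝ) ≤ m * n * M := by
  rw [Finset.sum_apply]
  push_cast
  calc ∑ p : P, (((z p • (p : Fin k → ℕ)) i : ℕ) : ℝ) ≤ ∑ p : P, M * n := by
        apply Finset.sum_le_sum
        intro p _
        have h1 := entry_le hP p i
        have h2 := hz p
        simp only [Pi.smul_apply, smul_eq_mul, Nat.cast_mul]
        gcongr
    _ = P.card * (M * n) := by simp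
    _ ≤ m * (M * n) := by gcongr
    _ = _ := by ring

theorem pair_lemma {k n m ℓ : ℕ} (c c' : Fin k → ℕ) (P P' : Finset (Fin k → ℕ))
    (hP : snorm P ≤ n) (hP' : snorm P' ≤ n) (hm : P.card ≤ m) (hm' : P'.card ≤ m)
    (hc : vnorm c ≤ ℓ) (hc' : vnorm c' ≤ ℓ) (B : ℝ)
    (hB : B = 3 * (m : ℝ) ^ 2 * (√(k : ℝ)) ^ k * (n : ℝ) ^ (k + 1))
    (v : Fin k → ℕ) (hv : v ∈ LSet1 c P) (hv' : v ∈ LSet1 c' P') :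
    ∃ c0, c0 ∈ LSet1 c P ∧ c0 ∈ LSet1 c' P' ∧ (vnorm c0 : ℝ) ≤ (B + 1) * ℓ ∧
      ∃ g ∈ AddSubmonoid.closure
        {z | z ∈ LSet1 0 P ∧ z ∈ LSet1 0 P' ∧ (vnorm z : ℝ) ≤ B}, v = c0 + g := by
  have hB0 : 0 ≤ B := by rw [hB]; positivity
  have hv1 := hv
  have hv1' := hv'
  rw [mem_LSet1] at hv hv'
  obtain ⟨lam, hlam⟩ := hv
  obtain ⟨mu, hmu⟩ := hv'
  rcases Nat.eq_zero_or_pos n with hn | hn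
  · refine ⟨v, hv1, hv1', ?_, 0, zero_mem _, by simp⟩
    have : v = c := by
      rw [hlam]
      ext i
      have : ∀ p : P, (p : Fin k → ℕ) i = 0 := fun p => by
        have := entry_le hP p i
        omega
      simp [this]
    rw [this]
    have h1 : (vnorm c : ℝ) ≤ ℓ := by exact_mod_cast hc
    nlinarith [(Nat.cast_nonneg ℓ : (0:ℝ) ≤ ℓ)]
  set D : ℝ := (√(k : ℝ)) ^ k * n ^ k with hD
  have hD0 : 0 ≤ D := by positivity
  have hBD : B = 3 * (m : ℝ) ^ 2 * n * D := by rw [hB, hD]; ring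
  have hmm : (m : ℝ) ≤ (m : ℝ) ^ 2 := by exact_mod_cast Nat.le_self_pow (by norm_num) m
  let col : P ⊕ P' → Fin k → ℤ := Sum.elim (fun p i => ((p : Fin k → ℕ) i : ℤ))
    (fun p i => -((p : Fin k → ℕ) i : ℤ))
  let b : Fin k → ℤ := fun i => (c' i : ℤ) - c i
  let A : (P ⊕ P' → ℕ) → Fin k → ℕ := fun z => ∑ p, z (Sum.inl p) • (p : Fin k → ℕ)
  let A' : (P ⊕ P' → ℕ) → Fin k → ℕ := fun z => ∑ p, z (Sum.inr p) • (p : Fin k → ℕ)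
  have hcolsum : ∀ z i, ∑ j, (z j : ℤ) * col j i = (A z i : ℤ) - A' z i := by
    intro z i
    rw [Fintype.sum_sum_type]
    simp [col, A, A', Finset.sum_apply, sub_eq_add_neg]
  have hcol : ∀ j i, |col j i| ≤ n := by
    rintro (p | p) i
    · have := entry_le hP p i
      simp only [col, Sum.elim_inl]
      rw [abs_of_nonneg (by positivity)]
      exact_mod_cast this
    · have := entry_le hP' p i
      simp only [col, Sum.elim_inr, abs_neg]
      rw [abs_of_nonneg (by positivity)]
      exact_mod_cast this
  have hci : ∀ i, c i ≤ ℓ := fun i => (le_vnorm c i).trans hc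
  have hci' : ∀ i, c' i ≤ ℓ := fun i => (le_vnorm c' i).trans hc'
  have hb : ∀ i, |b i| ≤ ℓ := by
    intro i
    have := hci i
    have := hci' i
    simp only [b]
    rw [abs_le]
    constructor <;> omega
  let x : P ⊕ P' → ℕ := Sum.elim lam mu
  have hAx : v = c + A x := hlam
  have hAx' : v = c' + A' x := hmu
  have hxeq : ∀ i, ∑ j, (x j : ℤ) * col j i = b i := by
    intro i
    rw [hcolsum]
    have h1 := congrFun hAx i
    have h2 := congrFun hAx' i
    simp only [Pi.add_apply] at h1 h2
    simp only [b]
    omega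
  have hcardκ : (Fintype.card (P ⊕ P') : ℝ) ≤ 2 * m := by
    rw [Fintype.card_sum, Fintype.card_coe, Fintype.card_coe]
    have : P.card + P'.card ≤ 2 * m := by omega
    exact_mod_cast this
  -- homogeneous solutions are period vectors
  have hker : ∀ z : P ⊕ P' → ℕ, (∀ i, ∑ j, (z j : ℤ) * col j i = 0) →
      (∀ j, (z j : ℝ) ≤ 2 * m * D ∨ (z j : ℝ) ≤ D) →
      A z ∈ {z | z ∈ LSet1 0 P ∧ z ∈ LSet1 0 P' ∧ (vnorm z : ℝ) ≤ B} := by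
    intro z hz hzb
    have hAA : A z = A' z := by
      ext i
      have := hz i
      rw [hcolsum] at this
      omega
    refine ⟨(mem_LSet1 _ _ _).2 ⟨_, (zero_add _).symm⟩,
      (mem_LSet1 _ _ _).2 ⟨_, hAA.trans (zero_add _).symm⟩, vnorm_le _ _ hB0 fun i => ?_⟩
    have h0 : ∀ p : P, (z (Sum.inl p) : ℝ) ≤ 2 * m * D := by
      intro p
      rcases hzb (Sum.inl p) with h | h
      · exact h
      · have : 1 ≤ m := le_trans (Finset.card_pos.2 ⟨p.1, p.2⟩ : 0 < P.card) hm
        have : (1 : ℝ) ≤ m := by exact_mod_cast this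
        nlinarith
    refine (sum_entry_le hP hm _ (2 * m * D) (by positivity) h0 i).trans ?_
    rw [hBD]
    have : 0 ≤ (m : ℝ) ^ 2 * n * D := by positivity
    nlinarith
  have hAadd : ∀ (q : ℕ) (r : Fin q → P ⊕ P' → ℕ) (a : Fin q → ℕ) (y : P ⊕ P' → ℕ),
      (∀ j, x j = y j + ∑ t, a t * r t j) → A x = A y + ∑ t, a t • A (r t) := by
    intro q r a y h
    simp only [A, h, add_smul, Finset.sum_add_distrib, Finset.sum_smul, Finset.smul_sum, mul_smul]
    rw [Finset.sum_comm]
  rcases Nat.eq_zero_or_pos ℓ with hℓ | hℓ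
  · have hc0 : c = 0 := funext fun i => by have := hci i; simp; omega
    have hc0' : c' = 0 := funext fun i => by have := hci' i; simp; omega
    have hb0 : ∀ i, b i = 0 := fun i => by simp [b, hc0, hc0']
    obtain ⟨q, r, a, y, h1, h2, h3, h4⟩ := core (ℓ := ℓ) hn col b hcol hb 0 (by omega) x
      (fun i => by rw [hxeq, hb0]; simp)
    have hAx2 := hAadd q r a y h1
    have hy : ∀ i, ∑ j, (y j : ℤ) * col j i = 0 := by
      intro i
      have h5 := hxeq i
      rw [hb0] at h5
      simp only [h1, Nat.cast_add, Nat.cast_sum, Nat.cast_mul, add_mul, Finset.sum_add_distrib,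
        Finset.sum_mul] at h5
      rw [Finset.sum_comm] at h5
      simpa [mul_assoc, ← Finset.mul_sum, h2] using h5
    refine ⟨0, ?_, ?_, ?_, A x, ?_, by rw [hAx, hc0]⟩
    · rw [mem_LSet1]; exact ⟨0, by simp [hc0]⟩
    · rw [mem_LSet1]; exact ⟨0, by simp [hc0']⟩
    · refine vnorm_le _ _ (by positivity) fun i => ?_
      simp; positivity
    · rw [hAx2]
      refine add_mem (AddSubmonoid.subset_closure (hker y hy fun j => Or.inl ?_))
        (sum_mem fun t _ => nsmul_mem (AddSubmonoid.subset_closure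
          (hker _ (h2 t) fun j => Or.inr (h3 t j))) _)
      have := h4 j
      simp only [Nat.cast_zero, zero_mul, add_zero] at this
      exact this.trans (by gcongr)
  · obtain ⟨q, r, a, y, h1, h2, h3, h4⟩ := core (ℓ := ℓ) hn col b hcol hb 1 (by omega) x
      (fun i => by rw [hxeq]; simp)
    have hAx2 := hAadd q r a y h1
    have hy : ∀ i, ∑ j, (y j : ℤ) * col j i = b i := by
      intro i
      have h5 := hxeq i
      simp only [h1, Nat.cast_add, Nat.cast_sum, Nat.cast_mul, add_mul, Finset.sum_add_distrib,
        Finset.sum_mul] at h5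
      rw [Finset.sum_comm (s := Finset.univ (α := P ⊕ P'))] at h5
      simpa [mul_assoc, ← Finset.mul_sum, h2] using h5
    refine ⟨c + A y, ?_, ?_, ?_, ∑ t, a t • A (r t), ?_, by rw [hAx, hAx2, add_assoc]⟩
    · rw [mem_LSet1]; exact ⟨_, rfl⟩
    · rw [mem_LSet1]
      refine ⟨fun p => y (Sum.inr p), ?_⟩
      ext i
      have h5 := hy i
      rw [hcolsum] at h5
      change c i + A y i = c' i + A' y i
      simp only [b] at h5
      omega
    · refine vnorm_le _ _ (by positivity) fun i => ?_
      have hℓ' : (1 : ℝ) ≤ ℓ := by exact_mod_cast hℓ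
      have h5 : ∀ p : P, (y (Sum.inl p) : ℝ) ≤ 2 * m * D + D * ℓ := by
        intro p
        refine (h4 (Sum.inl p)).trans ?_
        simp only [Nat.cast_one, one_mul]
        gcongr
      have h6 := sum_entry_le hP hm _ _ (by positivity) h5 i
      have h7 : (c i : ℝ) ≤ ℓ := by exact_mod_cast hci i
      have h8 : ((c + A y) i : ℝ) = c i + A y i := by simp
      have h9 : (A y i : ℝ) ≤ m * n * (2 * m * D + D * ℓ) := h6
      rw [h8, hBD]
      have e1 : (m : ℝ) * n * (2 * m * D) ≤ m * n * (2 * m * D) * ℓ :=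
        le_mul_of_one_le_right (by positivity) hℓ'
      have e2 : (m : ℝ) * (n * D * ℓ) ≤ m ^ 2 * (n * D * ℓ) := by gcongr
      nlinarith
    · exact sum_mem fun t _ => nsmul_mem (AddSubmonoid.subset_closure
          (hker _ (h2 t) fun j => Or.inr (h3 t j))) _

theorem LSet1_add {k : ℕ} {c g : Fin k → ℕ} {P : Finset (Fin k → ℕ)} {v : Fin k → ℕ}
    (hv : v ∈ LSet1 c P) (hg : g ∈ LSet1 0 P) : v + g ∈ LSet1 c P := by
  rw [mem_LSet1] at *
  obtain ⟨z, rfl⟩ := hv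
  obtain ⟨y, rfl⟩ := hg
  exact ⟨z + y, by simp [add_smul, Finset.sum_add_distrib, add_assoc]⟩

theorem LSet1_add_sum {k : ℕ} {c : Fin k → ℕ} {P : Finset (Fin k → ℕ)} {v : Fin k → ℕ}
    (hv : v ∈ LSet1 c P) (Q : Finset (Fin k → ℕ)) (hQ : ∀ g ∈ Q, g ∈ LSet1 0 P)
    (lam : (Fin k → ℕ) → ℕ) : v + ∑ x ∈ Q, lam x • x ∈ LSet1 c P := by
  refine LSet1_add hv ?_
  have hz : (0 : Fin k → ℕ) ∈ LSet1 0 P := (mem_LSet1 _ _ _).2 ⟨0, by simp⟩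
  refine Finset.sum_induction _ (· ∈ LSet1 0 P) (fun a b ha hb => LSet1_add ha hb) hz ?_
  intro x hx
  induction lam x with
  | zero => simpa using hz
  | succ n ih => rw [succ_nsmul]; exact LSet1_add ih (hQ x hx)

theorem finite_vnorm {k : ℕ} (B : ℝ) : {z : Fin k → ℕ | (vnorm z : ℝ) ≤ B}.Finite := by
  refine (Set.finite_Iic (fun _ : Fin k => ⌊B⌋₊)).subset ?_
  intro z hz i
  have h1 : (vnorm z : ℝ) ≤ B := hz
  exact (le_vnorm z i).trans (Nat.le_floor h1)

theorem snorm_le {k : ℕ} (Q : Finset (Fin k → ℕ)) (B : ℝ) (hB : 0 ≤ B)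
    (h : ∀ z ∈ Q, (vnorm z : ℝ) ≤ B) : (snorm Q : ℝ) ≤ B := by
  rw [← Nat.le_floor_iff hB]
  exact Finset.sup_le fun z hz => Nat.le_floor (h z hz)

/-- Intersection of two semilinear sets, with bounds on the norms of the
resulting period and constant sets. -/
theorem inter_semilinear {ι : Type*} [DecidableEq ι] (k : ℕ) (hk : 1 ≤ k)
    (I J : Finset ι) (hIJ : Disjoint I J)
    (c : ι → (Fin k → ℕ)) (P : ι → Finset (Fin k → ℕ))
    (n m ℓ : ℕ)
    (hn : n = (I ∪ J).sup fun i => snorm (P i))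
    (hm : m = (I ∪ J).sup fun i => (P i).card)
    (hℓ : ℓ = (I ∪ J).sup fun i => vnorm (c i)) :
    ∃ Q C : ι × ι → Finset (Fin k → ℕ),
      (∀ i ∈ I, ∀ j ∈ J,
        (snorm (Q (i, j)) : ℝ) ≤
          3 * (m : ℝ) ^ 2 * (k : ℝ) ^ ((k : ℝ) / 2) * (n : ℝ) ^ (k + 1) ∧
        (snorm (C (i, j)) : ℝ) ≤
          (3 * (m : ℝ) ^ 2 * (k : ℝ) ^ ((k : ℝ) / 2) * (n : ℝ) ^ (k + 1) + 1) * (ℓ : ℝ)) ∧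
      ((⋃ i ∈ I, LSet1 (c i) (P i)) ∩ ⋃ j ∈ J, LSet1 (c j) (P j)) =
        ⋃ i ∈ I, ⋃ j ∈ J, LSet (C (i, j)) (Q (i, j)) := by
  have hsqrt : (k : ℝ) ^ ((k : ℝ) / 2) = (√(k : ℝ)) ^ k := by
    rw [Real.sqrt_eq_rpow, ← Real.rpow_mul_natCast (by positivity)]
    congr 1
    ring
  rw [hsqrt]
  set B : ℝ := 3 * (m : ℝ) ^ 2 * (√(k : ℝ)) ^ k * (n : ℝ) ^ (k + 1) with hB
  have hB0 : 0 ≤ B := by positivity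
  have hQf : ∀ ij : ι × ι, {z : Fin k → ℕ | z ∈ LSet1 0 (P ij.1) ∧ z ∈ LSet1 0 (P ij.2) ∧
      (vnorm z : ℝ) ≤ B}.Finite := fun ij => (finite_vnorm B).subset fun z hz => hz.2.2
  have hCf : ∀ ij : ι × ι, {z : Fin k → ℕ | z ∈ LSet1 (c ij.1) (P ij.1) ∧
      z ∈ LSet1 (c ij.2) (P ij.2) ∧ (vnorm z : ℝ) ≤ (B + 1) * ℓ}.Finite :=
    fun ij => (finite_vnorm _).subset fun z hz => hz.2.2
  refine ⟨fun ij => (hQf ij).toFinset, fun ij => (hCf ij).toFinset, ?_, ?_⟩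
  · intro i _ j _
    refine ⟨snorm_le _ _ hB0 fun z hz => ?_, snorm_le _ _ (by positivity) fun z hz => ?_⟩
    · exact ((hQf _).mem_toFinset.1 hz).2.2
    · exact ((hCf _).mem_toFinset.1 hz).2.2
  · ext v
    simp only [Set.mem_inter_iff, Set.mem_iUnion, exists_prop]
    constructor
    · rintro ⟨⟨i, hi, hvi⟩, j, hj, hvj⟩
      have hiU : i ∈ I ∪ J := Finset.mem_union_left _ hi
      have hjU : j ∈ I ∪ J := Finset.mem_union_right _ hj
      refine ⟨i, hi, j, hj, ?_⟩
      obtain ⟨c0, h1, h2, h3, g, hg, rfl⟩ := pair_lemma (n := n) (m := m) (ℓ := ℓ)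
        (c i) (c j) (P i) (P j)
        (hn ▸ Finset.le_sup (f := fun i => snorm (P i)) hiU)
        (hn ▸ Finset.le_sup (f := fun i => snorm (P i)) hjU)
        (hm ▸ Finset.le_sup (f := fun i => (P i).card) hiU)
        (hm ▸ Finset.le_sup (f := fun i => (P i).card) hjU)
        (hℓ ▸ Finset.le_sup (f := fun i => vnorm (c i)) hiU)
        (hℓ ▸ Finset.le_sup (f := fun i => vnorm (c i)) hjU) B hB v hvi hvj
      rw [← (hQf (i, j)).coe_toFinset, AddSubmonoid.mem_closure_finset] at hg
      obtain ⟨lam, -, hlam⟩ := hg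
      exact ⟨c0, (hCf (i, j)).mem_toFinset.2 ⟨h1, h2, h3⟩, lam, by rw [hlam]⟩
    · rintro ⟨i, hi, j, hj, c0, hc0, lam, rfl⟩
      have h := (hCf (i, j)).mem_toFinset.1 hc0
      exact ⟨⟨i, hi, LSet1_add_sum h.1 _ (fun g hg => ((hQf (i, j)).mem_toFinset.1 hg).1) lam⟩,
        j, hj, LSet1_add_sum h.2.1 _ (fun g hg => ((hQf (i, j)).mem_toFinset.1 hg).2.1) lam⟩
end

section
/- Let k ≥ 1, and let ⋃_{i ∈ I} L(C_i, P_i) and ⋃_{j ∈ J} L(C_j, P_j) be semilinear subsets of ℕ^k, where I and J are disjoint finite index sets. Set p = max{|I|, |J|}, n = max_{i ∈ I ∪ J} ‖P_i‖, ℓ = max_{i ∈ I ∪ J} ‖C_i‖, and a_k = 4^{k+1} k^{k/2}. Then there exists an index set H with |H| ≤ p² (ℓ+1)^{2k} such that for each h ∈ H there are finite sets P_h, C_h ⊆ ℕ^k with ‖P_h‖ ≤ a_k n^{3k+1} and ‖C_h‖ ≤ (a_k n^{3k+1} + 1)·ℓ, and (⋃_{i ∈ I} L(C_i, P_i)) ∩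 (⋃_{j ∈ J} L(C_j, P_j)) = ⋃_{h ∈ H} L(C_h, P_h). -/
theorem hadamard_aux {k : ℕ} (hk : 1 ≤ k) (n : ℕ) (M : Matrix (Fin k) (Fin k) ℤ)
    (hM : ∀ i j, |M i j| ≤ (n : ℤ)) :
    ((M.det.natAbs : ℕ) : ℝ) ≤ (k : ℝ) ^ ((k : ℝ) / 2) * (n : ℝ) ^ k := by
  have hk0 : (0 : ℝ) < k := by exact_mod_cast hk
  set A : Matrix (Fin k) (Fin k) ℝ := M.map (Int.cast : ℤ → ℝ) with hA
  have hdet : A.det = (M.det : ℝ) := by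
    have := (Int.castRingHom ℝ).map_det M
    rw [hA]; simpa using this.symm
  set G := A.conjTranspose * A with hG
  have hps : G.PosSemidef := Matrix.posSemidef_conjTranspose_mul_self A
  have hGdet : G.det = (M.det : ℝ) ^ 2 := by
    rw [hG, Matrix.det_mul, Matrix.det_conjTranspose, hdet]; simp [sq]
  have htr : G.trace ≤ k * (k * (n : ℝ) ^ 2) := by
    have : G.trace = ∑ i, ∑ j, (A j i) ^ 2 := by
      simp [hG, Matrix.trace, Matrix.mul_apply, sq]
    rw [this]
    have hb : ∀ i j, (A j i) ^ 2 ≤ (n : ℝ) ^ 2 := by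
      intro i j
      rw [← sq_abs]
      have h1 : |A j i| ≤ (n : ℝ) := by
        have := hM j i
        have h2 : ((|M j i| : ℤ) : ℝ) ≤ ((n : ℤ) : ℝ) := by exact_mod_cast this
        simpa [hA] using h2
      exact pow_le_pow_left₀ (abs_nonneg _) h1 2
    calc ∑ i, ∑ j, (A j i) ^ 2 ≤ ∑ i : Fin k, ∑ j : Fin k, (n : ℝ) ^ 2 :=
          Finset.sum_le_sum fun i _ => Finset.sum_le_sum fun j _ => hb i j
      _ = _ := by simp
  set e := hps.isHermitian.eigenvalues
  have he0 : ∀ i, 0 ≤ e i := hps.eigenvalues_nonneg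
  have hprod : (M.det : ℝ) ^ 2 = ∏ i, e i := by
    rw [← hGdet]; simpa using hps.isHermitian.det_eq_prod_eigenvalues
  have hsum : ∑ i, e i ≤ k * (k * (n : ℝ) ^ 2) := by
    have : G.trace = ∑ i, e i := by simpa using hps.isHermitian.trace_eq_sum_eigenvalues
    rw [← this]; exact htr
  have hamgm := Real.geom_mean_le_arith_mean Finset.univ (fun _ : Fin k => (1 : ℝ)) e
    (by simp) (by simpa using hk0) (fun i _ => he0 i)
  simp only [Real.rpow_one, one_mul, Finset.sum_const, Finset.card_univ, Fintype.card_fin,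
    nsmul_eq_mul, mul_one] at hamgm
  have h3 : (∏ i, e i) ^ ((k : ℝ)⁻¹) ≤ k * (n : ℝ) ^ 2 := by
    refine hamgm.trans ?_
    rw [div_le_iff₀ hk0]; linarith
  have hp0 : 0 ≤ ∏ i, e i := Finset.prod_nonneg fun i _ => he0 i
  have h4 : ∏ i, e i ≤ (k * (n : ℝ) ^ 2) ^ k := by
    have := pow_le_pow_left₀ (Real.rpow_nonneg hp0 _) h3 k
    rwa [Real.rpow_inv_natCast_pow hp0 (by omega)] at this
  have h5 : ((M.det.natAbs : ℕ) : ℝ) = |(M.det : ℝ)| := by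
    rw [Nat.cast_natAbs]; simp
  rw [h5]
  refine abs_le_of_sq_le_sq ?_ (by positivity)
  rw [hprod]
  refine h4.trans (le_of_eq ?_)
  rw [mul_pow, mul_pow, ← Real.rpow_natCast ((k : ℝ) ^ ((k : ℝ) / 2)) 2, ← Real.rpow_mul hk0.le]
  have : (k : ℝ) / 2 * ((2 : ℕ) : ℝ) = k := by push_cast; ring
  rw [this, Real.rpow_natCast, ← pow_mul, ← pow_mul, mul_comm 2 k]

/-- A rational number minimising the ratio. -/
theorem ratio_aux {T : Type*} (S : Finset T) (hS : S.Nonempty)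
    (y w : T → ℚ) (hw : ∀ t ∈ S, 0 < w t) (hy : ∀ t ∈ S, 0 ≤ y t) :
    ∃ t ∈ S, ∃ α : ℚ, 0 ≤ α ∧ y t - α * w t = 0 ∧ α = y t / w t ∧
      ∀ s ∈ S, 0 ≤ y s - α * w s := by
  obtain ⟨t, ht, hmin⟩ := S.exists_min_image (fun t => y t / w t) hS
  refine ⟨t, ht, y t / w t, div_nonneg (hy t ht) (hw t ht).le, ?_, rfl, ?_⟩
  · have := (hw t ht).ne'
    field_simp; ring
  · intro s hs
    have := hmin s hs
    rw [le_div_iff₀ (hw s hs)] at this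
    linarith

theorem circ_min {k : ℕ} (hk : 1 ≤ k) {T : Type*} [Fintype T] [DecidableEq T] (n : ℕ) (hn : 1 ≤ n)
    (V : T → Fin k → ℤ) (hV : ∀ t i, |V t i| ≤ (n : ℤ))
    (y : T → ℚ) (hy0 : ∀ t, 0 ≤ y t) (hy : ∀ i, ∑ t, y t * (V t i : ℚ) = 0)
    (s0 : T) (hs0 : y s0 ≠ 0)
    (hind : LinearIndepOn ℚ (fun t => fun i => (V t i : ℚ)) {t | t ≠ s0 ∧ y t ≠ 0}) :
    ∃ u : T → ℕ, u ≠ 0 ∧ (∀ i, ∑ t, (u t : ℤ) * V t i = 0) ∧ (∀ t, y t = 0 → u t = 0) ∧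
      ((∑ t, u t : ℕ) : ℝ) ≤ (k + 1) * ((k : ℝ) ^ ((k : ℝ) / 2) * (n : ℝ) ^ k) := by
  classical
  set W : T ⊕ Fin k → Fin k → ℤ := Sum.elim V (fun j i => if i = j then 1 else 0) with hW
  have hWb : ∀ t i, |W t i| ≤ (n : ℤ) := by
    rintro (t | j) i
    · exact hV t i
    · simp only [hW, Sum.elim_inr]
      split_ifs
      · simpa using hn
      · simp
  set WQ : T ⊕ Fin k → Fin k → ℚ := fun t i => (W t i : ℚ) with hWQ
  set S' : Set T := {t | t ≠ s0 ∧ y t ≠ 0} with hS'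
  have hind2 : LinearIndepOn ℚ WQ (Set.image Sum.inl S') := by
    apply LinearIndepOn.image_of_comp
    exact hind
  obtain ⟨b, -, hSb, hspan, hb⟩ := exists_linearIndepOn_extension hind2 (Set.subset_univ _)
  have hbtop : ⊤ ≤ Submodule.span ℚ (Set.range fun t : b => WQ t) := by
    have h1 : Set.range (fun t : b => WQ t) = Set.image WQ b := by
      ext v; simp
    rw [h1]
    intro v _
    have h2 : v = ∑ j, v j • WQ (Sum.inr j) := by
      ext i; simp [hWQ, hW]
    rw [h2]
    exact Submodule.sum_mem _ fun j _ => Submodule.smul_mem _ _ (hspan ⟨_, trivial, rfl⟩)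
  let B : Module.Basis b ℚ (Fin k → ℚ) := Module.Basis.mk hb hbtop
  have hcard : Fintype.card b = k := by
    rw [← Module.finrank_eq_card_basis B]; simp
  let e : Fin k ≃ b := (Fintype.equivFinOfCardEq hcard).symm
  set M : Matrix (Fin k) (Fin k) ℤ := Matrix.of fun i j => W (e j) i with hM
  set MQ : Matrix (Fin k) (Fin k) ℚ := M.map (Int.cast : ℤ → ℚ) with hMQ
  have hdetQ : MQ.det = (M.det : ℚ) := by
    have := (Int.castRingHom ℚ).map_det M
    rw [hMQ]; simpa using this.symm
  have hdet0 : MQ.det ≠ 0 := by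
    have : LinearIndependent ℚ MQ.col := by
      have h := hb.comp e e.injective
      exact h
    rw [Matrix.linearIndependent_cols_iff_isUnit, Matrix.isUnit_iff_isUnit_det] at this
    exact this.ne_zero
  -- the coefficient vector
  set z : Fin k → ℚ := fun j => Sum.elim (fun t => if t ∈ S' then y t else 0) (fun _ => 0) (e j).1
    with hz
  have hMz : MQ.mulVec z = fun i => - (y s0) * (V s0 i : ℚ) := by
    ext i
    have h1 : MQ.mulVec z i = ∑ t : b, WQ t i *
        Sum.elim (fun t => if t ∈ S' then y t else 0) (fun _ => 0) t.1 := by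
      rw [← Equiv.sum_comp e]
      simp [Matrix.mulVec, dotProduct, hMQ, hM, hz, hWQ]
    have h2 : ∑ t : b, WQ t i *
        Sum.elim (fun t => if t ∈ S' then y t else 0) (fun _ => 0) t.1
        = ∑ t : T ⊕ Fin k, WQ t i *
        Sum.elim (fun t => if t ∈ S' then y t else 0) (fun _ => 0) t := by
      rw [← Finset.sum_subtype (s := Finset.univ.filter (· ∈ b))
        (p := (· ∈ b)) (by simp) (fun t => WQ t i *
        Sum.elim (fun t => if t ∈ S' then y t else 0) (fun _ => 0) t)]
      apply Finset.sum_subset (Finset.subset_univ _)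
      intro t _ ht
      rcases t with t | t
      · by_cases h : t ∈ S'
        · exact absurd (by simpa using hSb ⟨t, h, rfl⟩) ht
        · simp [h]
      · simp
    rw [h1, h2]
    have h3 := hy i
    rw [Fintype.sum_sum_type]
    simp only [Sum.elim_inl, Sum.elim_inr, mul_zero, Finset.sum_const_zero, add_zero]
    rw [← Finset.add_sum_erase _ _ (Finset.mem_univ s0)] at h3
    rw [← Finset.add_sum_erase _ _ (Finset.mem_univ s0)]
    have h4 : ∀ t ∈ Finset.univ.erase s0, WQ (Sum.inl t) i * (if t ∈ S' then y t else 0) =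
        y t * (V t i : ℚ) := by
      intro t ht
      have ht' : t ≠ s0 := (Finset.mem_erase.mp ht).1
      by_cases h : y t = 0
      · simp [hS', h]
      · simp [hS', h, ht', hWQ, hW, mul_comm]
    rw [Finset.sum_congr rfl h4]
    simp only [hS', Set.mem_ofPred_eq, ne_eq, not_true_eq_false, false_and, if_false, mul_zero]
    linarith
  have hcr : ∀ j, MQ.det * z j = - (y s0) * ((M.updateCol j (V s0)).det : ℚ) := by
    intro j
    have h1 : MQ.cramer (MQ.mulVec z) = MQ.det • z := by
      rw [Matrix.cramer_eq_adjugate_mulVec, Matrix.mulVec_mulVec, Matrix.adjugate_mul,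
        Matrix.smul_mulVec, Matrix.one_mulVec]
    have h2 := congrFun h1 j
    have h3 : (fun i => - (y s0) * (V s0 i : ℚ)) = (-(y s0)) • fun i => (V s0 i : ℚ) := by
      ext; simp
    rw [hMz, h3, map_smul] at h2
    simp only [Pi.smul_apply, smul_eq_mul, Matrix.cramer_apply] at h2
    rw [← h2]
    congr 1
    have h4 := (Int.castRingHom ℚ).map_det (M.updateCol j (V s0))
    have h5 : (Int.castRingHom ℚ).mapMatrix (M.updateCol j (V s0)) =
        MQ.updateCol j (fun i => (V s0 i : ℚ)) := by
      ext a c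
      by_cases h : c = j
      · subst h; simp
      · simp [h, hMQ]
    rw [h5] at h4
    simpa using h4.symm
  set D : ℝ := (k : ℝ) ^ ((k : ℝ) / 2) * (n : ℝ) ^ k with hD
  have hys0 : 0 < y s0 := lt_of_le_of_ne (hy0 s0) (Ne.symm hs0)
  set c : ℚ := |MQ.det| / y s0 with hc
  have hc0 : 0 < c := div_pos (abs_pos.mpr hdet0) hys0
  have key : ∀ t, ∃ m : ℕ, (m : ℝ) ≤ D ∧ (m : ℚ) = c * y t := by
    intro t
    by_cases h0 : y t = 0
    · exact ⟨0, by rw [hD, Nat.cast_zero]; positivity, by simp [h0]⟩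
    by_cases hts : t = s0
    · subst hts
      refine ⟨M.det.natAbs, hadamard_aux hk n M fun i j => hWb _ _, ?_⟩
      rw [hc, hdetQ, Nat.cast_natAbs]
      field_simp
      simp
    · have hmem : t ∈ S' := ⟨hts, h0⟩
      have hb' : Sum.inl t ∈ b := hSb ⟨t, hmem, rfl⟩
      set j := e.symm ⟨_, hb'⟩ with hj
      have hzj : z j = y t := by simp [hz, hj, hmem]
      refine ⟨(M.updateCol j (V s0)).det.natAbs, hadamard_aux hk n _ ?_, ?_⟩
      · intro a c
        by_cases h : c = j
        · subst h; simpa using hV s0 a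
        · rw [Matrix.updateCol_ne h]; exact hWb (e c) a
      · have h1 := hcr j
        rw [hzj] at h1
        have h2 : |MQ.det| * y t = y s0 * |((M.updateCol j (V s0)).det : ℚ)| := by
          have := congrArg abs h1
          rwa [abs_mul, abs_mul, abs_neg, abs_of_nonneg (hy0 t), abs_of_pos hys0] at this
        rw [hc, Nat.cast_natAbs, div_mul_eq_mul_div, h2]
        field_simp
        simp
  choose u hu1 hu2 using key
  refine ⟨u, ?_, ?_, ?_, ?_⟩
  · intro h
    have h1 := hu2 s0
    rw [h] at h1
    simp only [Pi.zero_apply, Nat.cast_zero] at h1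
    exact (mul_pos hc0 hys0).ne h1
  · intro i
    have : ((∑ t, (u t : ℤ) * V t i : ℤ) : ℚ) = 0 := by
      push_cast
      calc ∑ t, (u t : ℚ) * (V t i : ℚ) = ∑ t, c * (y t * (V t i : ℚ)) :=
            Finset.sum_congr rfl fun t _ => by rw [hu2]; ring
        _ = 0 := by rw [← Finset.mul_sum, hy i, mul_zero]
    exact_mod_cast this
  · intro t ht
    have := hu2 t
    rw [ht, mul_zero] at this
    exact_mod_cast this
  · have hz' : ∀ t, y t = 0 → u t = 0 := by
      intro t ht
      have := hu2 t
      rw [ht, mul_zero] at this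
      exact_mod_cast this
    have hcardS : (Finset.univ.filter fun t => y t ≠ 0).card ≤ k + 1 := by
      have h1 : (Finset.univ.filter fun t => t ∈ S').card ≤ k := by
        have h2 : ((Finset.univ.filter fun t => t ∈ S').image (Sum.inl : T → T ⊕ Fin k)) ⊆
            b.toFinset := by
          intro t ht
          simp only [Finset.mem_image, Finset.mem_filter, Finset.mem_univ, true_and] at ht
          obtain ⟨s, hs, rfl⟩ := ht
          simpa using hSb ⟨s, hs, rfl⟩
        have h3 := Finset.card_le_card h2
        rwa [Finset.card_image_of_injective _ Sum.inl_injective, Set.toFinset_card, hcard] at h3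
      have h4 : (Finset.univ.filter fun t => y t ≠ 0) ⊆
          insert s0 (Finset.univ.filter fun t => t ∈ S') := by
        intro t ht
        by_cases h : t = s0
        · simp [h]
        · simp only [Finset.mem_filter, Finset.mem_univ, true_and] at ht
          simp [h, hS', ht]
      exact (Finset.card_le_card h4).trans ((Finset.card_insert_le _ _).trans (by omega))
    have h6 : ∑ t, u t = ∑ t ∈ Finset.univ.filter fun t => y t ≠ 0, u t := by
      symm
      apply Finset.sum_subset (Finset.subset_univ _)
      intro t _ ht
      apply hz'
      by_contra h
      exact ht (by simp [h])
    have hD0 : 0 ≤ D := by rw [hD]; positivity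
    rw [h6]
    push_cast
    calc ∑ t ∈ Finset.univ.filter fun t => y t ≠ 0, (u t : ℝ)
        ≤ (Finset.univ.filter fun t => y t ≠ 0).card • D :=
          Finset.sum_le_card_nsmul _ _ _ fun t _ => hu1 t
      _ ≤ (k + 1) * D := by
          rw [nsmul_eq_mul]
          exact mul_le_mul_of_nonneg_right (by exact_mod_cast hcardS) hD0

theorem indep_aux {k : ℕ} {T : Type*} [Fintype T] [DecidableEq T]
    (V : T → Fin k → ℤ)
    (y : T → ℚ) (hy0 : ∀ t, 0 ≤ y t) (hy : ∀ i, ∑ t, y t * (V t i : ℚ) = 0)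
    (s0 : T) (hs0 : y s0 ≠ 0)
    (hmin : ∀ y' : T → ℚ, (∀ t, 0 ≤ y' t) → (∀ i, ∑ t, y' t * (V t i : ℚ) = 0) → y' ≠ 0 →
      (∀ t, y t = 0 → y' t = 0) → ∀ t, y' t = 0 → y t = 0) :
    LinearIndepOn ℚ (fun t => fun i => (V t i : ℚ)) {t | t ≠ s0 ∧ y t ≠ 0} := by
  classical
  -- no nonzero dependency with a positive coordinate
  have hpos : ∀ w : T → ℚ, w s0 = 0 → (∀ t, y t = 0 → w t = 0) →
      (∀ i, ∑ t, w t * (V t i : ℚ) = 0) → ∀ t, ¬ 0 < w t := by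
    intro w hw0 hwy hw t1 ht1
    obtain ⟨t, ht, α, hα, h0, -, hall⟩ := ratio_aux (Finset.univ.filter fun t => 0 < w t)
      ⟨t1, by simp [ht1]⟩ y w (by simp) (fun t _ => hy0 t)
    simp only [Finset.mem_filter, Finset.mem_univ, true_and] at ht hall
    have h := hmin (fun t => y t - α * w t) ?_ ?_ ?_ ?_ t h0
    · exact ht.ne' (hwy t h)
    · intro s
      by_cases hs : 0 < w s
      · exact hall s hs
      · have := hy0 s
        have : α * w s ≤ 0 := mul_nonpos_of_nonneg_of_nonpos hα (not_lt.mp hs)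
        linarith
    · intro i
      simp only [sub_mul, Finset.sum_sub_distrib, hy i, mul_assoc, ← Finset.mul_sum, hw i]
      simp
    · intro h
      have := congrFun h s0
      simp [hw0, hs0] at this
    · intro s hs
      simp [hs, hwy s hs]
  have hzero : ∀ w : T → ℚ, w s0 = 0 → (∀ t, y t = 0 → w t = 0) →
      (∀ i, ∑ t, w t * (V t i : ℚ) = 0) → ∀ t, w t = 0 := by
    intro w hw0 hwy hw t
    have h1 := hpos w hw0 hwy hw t
    have h2 := hpos (fun t => - w t) (by simp [hw0]) (fun t ht => by simp [hwy t ht])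
      (fun i => by simp [hw i]) t
    simp only [Left.neg_pos_iff] at h2
    exact le_antisymm (not_lt.mp h1) (not_lt.mp h2)
  rw [LinearIndepOn, Fintype.linearIndependent_iff]
  intro g hg s
  set w : T → ℚ := fun t => if h : t ≠ s0 ∧ y t ≠ 0 then g ⟨t, h⟩ else 0 with hw
  have h := hzero w (by simp [hw]) (fun t ht => by simp [hw, ht]) ?_ s.1
  · have hs : s.1 ≠ s0 ∧ y s.1 ≠ 0 := s.2
    simpa [hw, hs] using h
  · intro i
    have h1 := congrFun hg i
    simp only [Finset.sum_apply, Pi.smul_apply, smul_eq_mul, Pi.zero_apply] at h1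
    rw [← h1]
    rw [← Finset.sum_subset (Finset.subset_univ
      (Finset.univ.filter (fun t => t ≠ s0 ∧ y t ≠ 0)))]
    · rw [Finset.sum_subtype (p := fun t => t ∈ {t | t ≠ s0 ∧ y t ≠ 0}) _ (by simp)]
      apply Finset.sum_congr rfl
      intro t _
      have ht : t.1 ≠ s0 ∧ y t.1 ≠ 0 := t.2
      simp [hw, ht]
    · intro t _ ht
      simp only [Finset.mem_filter, Finset.mem_univ, true_and] at ht
      simp [hw, ht]

theorem circ {k : ℕ} (hk : 1 ≤ k) {T : Type*} [Fintype T] [DecidableEq T] (n : ℕ) (hn : 1 ≤ n)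
    (V : T → Fin k → ℤ) (hV : ∀ t i, |V t i| ≤ (n : ℤ)) (N : ℕ) :
    ∀ (y : T → ℚ), (∀ t, 0 ≤ y t) → (∀ i, ∑ t, y t * (V t i : ℚ) = 0) → y ≠ 0 →
      (Finset.univ.filter fun t => y t ≠ 0).card ≤ N →
    ∃ u : T → ℕ, u ≠ 0 ∧ (∀ i, ∑ t, (u t : ℤ) * V t i = 0) ∧ (∀ t, y t = 0 → u t = 0) ∧
      ((∑ t, u t : ℕ) : ℝ) ≤ (k + 1) * ((k : ℝ) ^ ((k : ℝ) / 2) * (n : ℝ) ^ k) := by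
  classical
  induction N with
  | zero =>
    intro y _ _ hne hc
    exfalso; apply hne; ext t
    by_contra h
    have : t ∈ Finset.univ.filter fun t => y t ≠ 0 := by simpa using h
    rw [Finset.card_eq_zero.mp (Nat.le_zero.mp hc)] at this
    simp at this
  | succ N ih =>
    intro y hy0 hy hne hc
    obtain ⟨s0, hs0⟩ := Function.ne_iff.mp hne
    by_cases hmin : ∀ y' : T → ℚ, (∀ t, 0 ≤ y' t) → (∀ i, ∑ t, y' t * (V t i : ℚ) = 0) → y' ≠ 0 →
      (∀ t, y t = 0 → y' t = 0) → ∀ t, y' t = 0 → y t = 0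
    · exact circ_min hk n hn V hV y hy0 hy s0 hs0 (indep_aux V y hy0 hy s0 hs0 hmin)
    · push Not at hmin
      obtain ⟨y', h1, h2, h3, h4, t, h5, h6⟩ := hmin
      obtain ⟨u, a1, a2, a3, a4⟩ := ih y' h1 h2 h3 (by
        have : (Finset.univ.filter fun t => y' t ≠ 0) ⊂ (Finset.univ.filter fun t => y t ≠ 0) := by
          rw [Finset.ssubset_iff_of_subset]
          · exact ⟨t, by simpa using h6, by simpa using h5⟩
          · intro s hs
            simp only [Finset.mem_filter, Finset.mem_univ, true_and] at hs ⊢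
            exact fun h => hs (h4 s h)
        have := Finset.card_lt_card this
        omega)
      exact ⟨u, a1, a2, fun t ht => a3 t (h4 t ht), a4⟩

theorem decomp_s4 {k : ℕ} (hk : 1 ≤ k) {T : Type*} [Fintype T] [DecidableEq T] (n : ℕ) (hn : 1 ≤ n)
    (V : T → Fin k → ℤ) (hV : ∀ t i, |V t i| ≤ (n : ℤ)) (Z : Finset T) (x : T → ℕ) (K : ℝ)
    (hK : K = (k + 1) * ((k : ℝ) ^ ((k : ℝ) / 2) * (n : ℝ) ^ k))
    (hno : ∀ u : T → ℕ, u ≠ 0 → (∀ t, u t ≤ x t) → (∀ i, ∑ t, (u t : ℤ) * V t i = 0) →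
      (∀ t ∈ Z, u t = 0) → ((∑ t, u t : ℕ) : ℝ) ≤ K → False) (N : ℕ) :
    ∀ (y : T → ℚ), (∀ t, 0 ≤ y t) → (∀ t, y t ≤ x t) → (∀ i, ∑ t, y t * (V t i : ℚ) = 0) →
      (Finset.univ.filter fun t => y t ≠ 0).card ≤ N →
      ((∑ t, y t : ℚ) : ℝ) ≤ (N + ((∑ t ∈ Z, y t : ℚ) : ℝ)) * K := by
  classical
  have hK0 : 0 ≤ K := by rw [hK]; positivity
  induction N with
  | zero =>
    intro y _ _ _ hc
    have hy : y = 0 := by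
      ext t
      by_contra h
      have : t ∈ Finset.univ.filter fun t => y t ≠ 0 := by simpa using h
      rw [Finset.card_eq_zero.mp (Nat.le_zero.mp hc)] at this
      simp at this
    simp [hy]
  | succ N ih =>
    intro y hy0 hyx hy hc
    by_cases hne : y = 0
    · subst hne
      simp only [Pi.zero_apply, Finset.sum_const_zero, Rat.cast_zero, add_zero]
      positivity
    obtain ⟨u, hu0, hu, husup, huK⟩ := circ hk n hn V hV _ y hy0 hy hne le_rfl
    rw [← hK] at huK
    obtain ⟨t1, ht1⟩ := Function.ne_iff.mp hu0
    obtain ⟨t, ht, α, hα, h0, hαe, hall⟩ := ratio_aux (Finset.univ.filter fun t => u t ≠ 0)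
      ⟨t1, by simpa using ht1⟩ y (fun t => (u t : ℚ))
      (by simp [Nat.pos_iff_ne_zero]) (fun t _ => hy0 t)
    simp only [Finset.mem_filter, Finset.mem_univ, true_and] at ht hall
    have hyt : y t ≠ 0 := fun h => ht (husup t h)
    have hα0 : 0 < α := by
      rw [hαe]
      exact div_pos (lt_of_le_of_ne (hy0 t) (Ne.symm hyt)) (by exact_mod_cast Nat.pos_of_ne_zero ht)
    have hge : ∀ s, 0 ≤ y s - α * (u s : ℚ) := by
      intro s
      by_cases hs : u s = 0
      · simp [hs, hy0 s]
      · exact hall s hs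
    have hI := ih (fun s => y s - α * (u s : ℚ)) hge
      (fun s => by
        have : 0 ≤ α * (u s : ℚ) := by positivity
        have := hyx s
        linarith)
      (fun i => by
        have h1 : ∑ t, (u t : ℚ) * (V t i : ℚ) = 0 := by exact_mod_cast hu i
        simp only [sub_mul, Finset.sum_sub_distrib, hy i, mul_assoc, ← Finset.mul_sum, h1]
        simp)
      (by
        have : (Finset.univ.filter fun s => y s - α * (u s : ℚ) ≠ 0) ⊂
            (Finset.univ.filter fun t => y t ≠ 0) := by
          rw [Finset.ssubset_iff_of_subset]
          · exact ⟨t, by simpa using hyt, by simpa using h0⟩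
          · intro s hs
            simp only [Finset.mem_filter, Finset.mem_univ, true_and] at hs ⊢
            exact fun h => hs (by simp [h, husup s h])
        have := Finset.card_lt_card this
        omega)
    simp only [Finset.sum_sub_distrib, ← Finset.mul_sum] at hI
    push_cast at hI huK ⊢
    have hαR : (0 : ℝ) < α := by exact_mod_cast hα0
    by_cases hZ : ∀ t ∈ Z, u t = 0
    · have hα1 : α < 1 := by
        by_contra hα1
        refine hno u hu0 ?_ hu hZ (by exact_mod_cast huK)
        intro s
        have h1 := hge s
        have h2 := hyx s
        have h3 : (u s : ℚ) ≤ α * u s := by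
          have : (0 : ℚ) ≤ u s := by positivity
          nlinarith [not_lt.mp hα1]
        have : (u s : ℚ) ≤ x s := by linarith
        exact_mod_cast this
      have hα1R : (α : ℝ) < 1 := by exact_mod_cast hα1
      have hZs : ∑ t ∈ Z, (u t : ℝ) = 0 := Finset.sum_eq_zero fun t ht => by simp [hZ t ht]
      rw [hZs] at hI
      have : (α : ℝ) * ∑ t, (u t : ℝ) ≤ 1 * K :=
        mul_le_mul hα1R.le huK (by positivity) (by norm_num)
      nlinarith
    · push Not at hZ
      obtain ⟨t2, ht2, ht2'⟩ := hZ
      have hZs : (1 : ℝ) ≤ ∑ t ∈ Z, (u t : ℝ) := by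
        have h1 : (1 : ℝ) ≤ u t2 := by exact_mod_cast Nat.pos_of_ne_zero ht2'
        exact h1.trans (Finset.single_le_sum (f := fun t => (u t : ℝ))
          (fun t _ => by positivity) ht2)
      have h1 : (α : ℝ) * ∑ t, (u t : ℝ) ≤ α * K := mul_le_mul_of_nonneg_left huK hαR.le
      have h2 : (α : ℝ) * K ≤ (α * ∑ t ∈ Z, (u t : ℝ)) * K := by
        apply mul_le_mul_of_nonneg_right _ hK0
        nlinarith
      nlinarith

theorem one_step {k : ℕ} (hk : 1 ≤ k) (n ℓ : ℕ) (hn : 1 ≤ n) (P Q : Finset (Fin k → ℕ))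
    (hP : ∀ x ∈ P, ∀ i, x i ≤ n) (hQ : ∀ x ∈ Q, ∀ i, x i ≤ n)
    (c d : Fin k → ℕ) (hc : ∀ i, c i ≤ ℓ) (hd : ∀ i, d i ≤ ℓ)
    (lam mu : (Fin k → ℕ) → ℕ)
    (h : c + ∑ x ∈ P, lam x • x = d + ∑ x ∈ Q, mu x • x) (K : ℝ)
    (hK : K = (k + 1) * ((k : ℝ) ^ ((k : ℝ) / 2) * (n : ℝ) ^ k)) :
    (∃ lam' mu' : (Fin k → ℕ) → ℕ, (∀ x, lam' x ≤ lam x) ∧ (∀ x, mu' x ≤ mu x) ∧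
      ∑ x ∈ P, lam' x • x = ∑ x ∈ Q, mu' x • x ∧
      0 < ∑ x ∈ P, lam' x + ∑ x ∈ Q, mu' x ∧ ((∑ x ∈ P, lam' x : ℕ) : ℝ) ≤ K) ∨
    ((∑ x ∈ P, lam x : ℕ) : ℝ) ≤ (P.card + Q.card + k + k * ℓ) * K := by
  classical
  have hK0 : 0 ≤ K := by rw [hK]; positivity
  set V : P ⊕ (Q ⊕ Fin k) → Fin k → ℤ := Sum.elim (fun p i => ((p.1 i : ℕ) : ℤ))
    (Sum.elim (fun q i => -((q.1 i : ℕ) : ℤ))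
      (fun j i => if i = j then ((c j : ℤ) - d j).sign else 0)) with hVdef
  set x : P ⊕ (Q ⊕ Fin k) → ℕ := Sum.elim (fun p => lam p.1)
    (Sum.elim (fun q => mu q.1) (fun j => ((c j : ℤ) - d j).natAbs)) with hx
  have hV : ∀ t i, |V t i| ≤ (n : ℤ) := by
    rintro (p | q | j) i
    · simpa [hVdef] using hP p.1 p.2 i
    · simpa [hVdef] using hQ q.1 q.2 i
    · simp only [hVdef, Sum.elim_inr]
      split_ifs
      · rcases Int.sign_trichotomy ((c j : ℤ) - d j) with h | h | h <;> rw [h] <;> simp <;> omega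
      · simp
  set Z : Finset (P ⊕ (Q ⊕ Fin k)) := Finset.univ.filter fun t => ∃ j, t = Sum.inr (Sum.inr j)
    with hZ
  by_cases hno : ∃ u : P ⊕ (Q ⊕ Fin k) → ℕ, u ≠ 0 ∧ (∀ t, u t ≤ x t) ∧
      (∀ i, ∑ t, (u t : ℤ) * V t i = 0) ∧ (∀ t ∈ Z, u t = 0) ∧ ((∑ t, u t : ℕ) : ℝ) ≤ K
  · left
    obtain ⟨u, hu0, hux, hu, huZ, huK⟩ := hno
    have huZ' : ∀ j, u (Sum.inr (Sum.inr j)) = 0 := fun j => huZ _ (by simp [hZ])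
    have e1 : ∑ x ∈ P, (if h : x ∈ P then u (Sum.inl ⟨x, h⟩) else 0) = ∑ p : P, u (Sum.inl p) := by
      rw [← Finset.sum_coe_sort]; simp
    have e2 : ∑ x ∈ Q, (if h : x ∈ Q then u (Sum.inr (Sum.inl ⟨x, h⟩)) else 0)
        = ∑ p : Q, u (Sum.inr (Sum.inl p)) := by
      rw [← Finset.sum_coe_sort]; simp
    have e3 : ∑ t, u t = ∑ p : P, u (Sum.inl p) + ∑ p : Q, u (Sum.inr (Sum.inl p)) := by
      simp [Fintype.sum_sum_type, huZ']
    refine ⟨fun x => if h : x ∈ P then u (Sum.inl ⟨x, h⟩) else 0,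
      fun x => if h : x ∈ Q then u (Sum.inr (Sum.inl ⟨x, h⟩)) else 0, ?_, ?_, ?_, ?_, ?_⟩
    · intro y
      by_cases h : y ∈ P
      · simpa [h, hx] using hux (Sum.inl ⟨y, h⟩)
      · simp [h]
    · intro y
      by_cases h : y ∈ Q
      · simpa [h, hx] using hux (Sum.inr (Sum.inl ⟨y, h⟩))
      · simp [h]
    · ext i
      have h1 := hu i
      simp only [Fintype.sum_sum_type, hVdef, Sum.elim_inl, Sum.elim_inr, huZ'] at h1
      rw [← Finset.sum_coe_sort P, ← Finset.sum_coe_sort Q]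
      simp only [Finset.coe_mem, dite_true, Finset.sum_apply, Pi.smul_apply, smul_eq_mul]
      zify
      simp only [mul_neg, Finset.sum_neg_distrib, Nat.cast_zero, zero_mul, Finset.sum_const_zero]
        at h1
      linarith
    · rw [e1, e2, ← e3]
      obtain ⟨t, ht⟩ := Function.ne_iff.mp hu0
      exact Finset.sum_pos' (fun _ _ => Nat.zero_le _)
        ⟨t, Finset.mem_univ _, Nat.pos_of_ne_zero ht⟩
    · rw [e1]
      refine le_trans ?_ huK
      rw [e3]; push_cast
      have : (0 : ℝ) ≤ ∑ p : Q, (u (Sum.inr (Sum.inl p)) : ℝ) := by positivity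
      linarith
  · right
    have hmain := decomp_s4 hk n hn V hV Z x K hK
      (fun u a1 a2 a3 a4 a5 => hno ⟨u, a1, a2, a3, a4, a5⟩)
      (Fintype.card (P ⊕ (Q ⊕ Fin k))) (fun t => (x t : ℚ)) (fun t => by positivity)
      (fun t => le_rfl) (fun i => by
        have hi := congrFun h i
        simp only [Pi.add_apply, Finset.sum_apply, Pi.smul_apply, smul_eq_mul] at hi
        rw [← Finset.sum_coe_sort P, ← Finset.sum_coe_sort Q] at hi
        have hz : ∑ t, (x t : ℤ) * V t i = 0 := by
          simp only [Fintype.sum_sum_type, hVdef, hx, Sum.elim_inl, Sum.elim_inr]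
          have h3 : ∑ j : Fin k, ((((c j : ℤ) - d j).natAbs : ℕ) : ℤ) *
              (if i = j then ((c j : ℤ) - d j).sign else 0) = c i - d i := by
            simp only [mul_ite, mul_zero, Finset.sum_ite_eq, Finset.mem_univ, if_true]
            rw [mul_comm]; exact Int.sign_mul_natAbs _
          rw [h3]
          zify at hi
          simp only [mul_neg, Finset.sum_neg_distrib]
          linarith
        exact_mod_cast hz)
      (Finset.card_le_univ _)
    have h1 : ∑ x ∈ P, lam x ≤ ∑ t, x t := by
      rw [← Finset.sum_coe_sort, Fintype.sum_sum_type]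
      simp [hx]
    have h2 : ∑ t ∈ Z, x t ≤ k * ℓ := by
      have : Z = Finset.univ.image (fun j : Fin k => (Sum.inr (Sum.inr j) : P ⊕ (Q ⊕ Fin k))) := by
        ext t; simp [hZ, eq_comm]
      rw [this, Finset.sum_image (by intro a _ b _ hab; simpa using hab)]
      calc _ ≤ ∑ j : Fin k, ℓ := Finset.sum_le_sum fun j _ => by
            have := hc j
            have := hd j
            simp only [hx, Sum.elim_inr]; omega
        _ = k * ℓ := by simp
    have h1' : ((∑ x ∈ P, lam x : ℕ) : ℝ) ≤ ((∑ t, x t : ℕ) : ℝ) := by exact_mod_cast h1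
    have h2' : ((∑ t ∈ Z, x t : ℕ) : ℝ) ≤ k * ℓ := by exact_mod_cast h2
    have hcard : ((Fintype.card (P ⊕ (Q ⊕ Fin k)) : ℕ) : ℝ) = P.card + Q.card + k := by
      simp; ring
    rw [hcard] at hmain
    push_cast at hmain h1' h2' ⊢
    refine h1'.trans (hmain.trans ?_)
    apply mul_le_mul_of_nonneg_right _ hK0
    linarith

theorem vnorm_le_snorm {k : ℕ} {P : Finset (Fin k → ℕ)} {x : Fin k → ℕ} (h : x ∈ P) :
    vnorm x ≤ snorm P := Finset.le_sup (f := vnorm) h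

/-- All vectors in a box which lie in a given set. -/
noncomputable def boxSet {k : ℕ} (B : ℕ) (S : Set (Fin k → ℕ)) : Finset (Fin k → ℕ) :=
  open Classical in (Fintype.piFinset fun _ => Finset.range (B + 1)).filter (· ∈ S)

theorem mem_boxSet {k : ℕ} {B : ℕ} {S : Set (Fin k → ℕ)} {x : Fin k → ℕ} :
    x ∈ boxSet B S ↔ (∀ i, x i ≤ B) ∧ x ∈ S := by
  classical
  simp [boxSet, Nat.lt_succ_iff]

theorem snorm_boxSet {k : ℕ} {B : ℕ} {S : Set (Fin k → ℕ)} : snorm (boxSet B S) ≤ B :=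
  Finset.sup_le fun x hx => Finset.sup_le fun i _ => (mem_boxSet.mp hx).1 i

theorem card_le_of_bdd {k n : ℕ} {P : Finset (Fin k → ℕ)} (hP : ∀ x ∈ P, ∀ i, x i ≤ n) :
    P.card ≤ (n + 1) ^ k := by
  have : P ⊆ Fintype.piFinset fun _ : Fin k => Finset.range (n + 1) := by
    intro x hx
    simpa [Nat.lt_succ_iff] using hP x hx
  simpa using Finset.card_le_card this

theorem LSet_base {k : ℕ} {C P : Finset (Fin k → ℕ)} {c : Fin k → ℕ} (hc : c ∈ C) :
    c ∈ LSet C P := ⟨c, hc, 0, by simp⟩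

theorem LSet_add_period {k : ℕ} {C P : Finset (Fin k → ℕ)} {v w : Fin k → ℕ}
    (hv : v ∈ LSet C P) (hw : w ∈ P) : v + w ∈ LSet C P := by
  classical
  obtain ⟨c, hc, lam, rfl⟩ := hv
  refine ⟨c, hc, fun x => lam x + if x = w then 1 else 0, ?_⟩
  simp only [add_smul, Finset.sum_add_distrib, ite_smul, one_smul, zero_smul,
    Finset.sum_ite_eq', hw, if_true, add_assoc]

theorem LSet_add {k : ℕ} {C P : Finset (Fin k → ℕ)} {v w : Fin k → ℕ}
    (hv : v ∈ LSet C P) (hw : w ∈ LSet {0} P) : v + w ∈ LSet C P := by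
  obtain ⟨c, hc, lam, rfl⟩ := hv
  obtain ⟨c', hc', mu, rfl⟩ := hw
  rw [Finset.mem_singleton] at hc'
  subst hc'
  refine ⟨c, hc, fun x => lam x + mu x, ?_⟩
  simp only [add_smul, Finset.sum_add_distrib, zero_add, add_assoc]

theorem LSet_add_sum {k : ℕ} {C P P' : Finset (Fin k → ℕ)} {v : Fin k → ℕ}
    (hv : v ∈ LSet C P) (hP' : ∀ w ∈ P', w ∈ LSet {0} P) (lam : (Fin k → ℕ) → ℕ) :
    v + ∑ x ∈ P', lam x • x ∈ LSet C P := by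
  classical
  have hsm : ∀ (m : ℕ) (v w : Fin k → ℕ), v ∈ LSet C P → w ∈ LSet {0} P →
      v + m • w ∈ LSet C P := by
    intro m
    induction m with
    | zero => intro v w hv _; simpa using hv
    | succ m ih =>
      intro v w hv hw
      rw [succ_nsmul, ← add_assoc]
      exact LSet_add (ih v w hv hw) hw
  induction P' using Finset.induction_on with
  | empty => simpa using hv
  | insert a s ha ih =>
    rw [Finset.sum_insert ha, add_comm (lam a • a), ← add_assoc]
    exact hsm _ _ _ (ih fun w hw => hP' w (Finset.mem_insert_of_mem hw))
      (hP' a (Finset.mem_insert_self _ _))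

theorem sum_le_aux {k n : ℕ} {P : Finset (Fin k → ℕ)} (hP : ∀ x ∈ P, ∀ i, x i ≤ n)
    (lam : (Fin k → ℕ) → ℕ) (i : Fin k) :
    (∑ x ∈ P, lam x • x) i ≤ n * ∑ x ∈ P, lam x := by
  rw [Finset.sum_apply, Finset.mul_sum]
  refine Finset.sum_le_sum fun x hx => ?_
  rw [Pi.smul_apply, smul_eq_mul, mul_comm]
  exact Nat.mul_le_mul_right _ (hP x hx i)

theorem const_aux (k n ℓ : ℕ) (hk : 1 ≤ k) (hn : 1 ≤ n) (hℓ : 1 ≤ ℓ) (a b : ℕ) (D : ℝ) (hD : 0 ≤ D)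
    (ha : a ≤ (n + 1) ^ k) (hb : b ≤ (n + 1) ^ k) :
    (n : ℝ) * (((a : ℝ) + b + k + k * ℓ) * ((k + 1) * (D * (n : ℝ) ^ k))) ≤
      (4 ^ (k + 1) * D * (n : ℝ) ^ (3 * k + 1)) * ℓ := by
  have h1 : ((n : ℝ) + 1) ^ k ≤ 2 ^ k * (n : ℝ) ^ k := by
    rw [← mul_pow]
    have : (1 : ℝ) ≤ n := by exact_mod_cast hn
    exact pow_le_pow_left₀ (by positivity) (by linarith) k
  have ha' : (a : ℝ) ≤ ((n : ℝ) + 1) ^ k := by exact_mod_cast ha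
  have hb' : (b : ℝ) ≤ ((n : ℝ) + 1) ^ k := by exact_mod_cast hb
  have hn1 : (1 : ℝ) ≤ n := by exact_mod_cast hn
  have hℓ1 : (1 : ℝ) ≤ ℓ := by exact_mod_cast hℓ
  have hnk : (1 : ℝ) ≤ (n : ℝ) ^ k := one_le_pow₀ hn1
  have h2k : (k : ℝ) + 1 ≤ 2 ^ k := by
    have : k + 1 ≤ 2 ^ k := Nat.lt_two_pow_self
    exact_mod_cast this
  have hk1 : (0 : ℝ) ≤ k := by positivity
  have hX : (1 : ℝ) ≤ (n : ℝ) ^ k * ℓ := by nlinarith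
  have h2 : (a : ℝ) + b + k + k * ℓ ≤ (4 * 2 ^ k) * ((n : ℝ) ^ k * ℓ) := by
    have t1 : 2 ^ k * (n : ℝ) ^ k ≤ 2 ^ k * ((n : ℝ) ^ k * ℓ) := by
      apply mul_le_mul_of_nonneg_left _ (by positivity); nlinarith
    have t2 : (k : ℝ) ≤ 2 ^ k * ((n : ℝ) ^ k * ℓ) := by nlinarith
    have t3 : (k : ℝ) * ℓ ≤ 2 ^ k * ((n : ℝ) ^ k * ℓ) := by
      apply mul_le_mul (by linarith) (by nlinarith) (by positivity) (by positivity)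
    linarith
  have h3 : ((a : ℝ) + b + k + k * ℓ) * (k + 1) ≤ (4 * 2 ^ k) * ((n : ℝ) ^ k * ℓ) * 2 ^ k :=
    mul_le_mul h2 h2k (by positivity) (by positivity)
  have h4 : (4 : ℝ) * 2 ^ k * 2 ^ k = 4 ^ (k + 1) := by
    rw [pow_succ, show (4 : ℝ) = 2 * 2 by norm_num, mul_pow]; ring
  calc (n : ℝ) * (((a : ℝ) + b + k + k * ℓ) * ((k + 1) * (D * (n : ℝ) ^ k)))
      = (((a : ℝ) + b + k + k * ℓ) * (k + 1)) * (n * D * (n : ℝ) ^ k) := by ring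
    _ ≤ ((4 * 2 ^ k) * ((n : ℝ) ^ k * ℓ) * 2 ^ k) * (n * D * (n : ℝ) ^ k) :=
        mul_le_mul_of_nonneg_right h3 (by positivity)
    _ = (4 * 2 ^ k * 2 ^ k) * D * (n : ℝ) ^ (2 * k + 1) * ℓ := by ring
    _ ≤ (4 ^ (k + 1) * D * (n : ℝ) ^ (3 * k + 1)) * ℓ := by
        rw [h4]
        apply mul_le_mul_of_nonneg_right _ (by positivity)
        apply mul_le_mul_of_nonneg_left _ (by positivity)
        exact pow_le_pow_right₀ hn1 (by omega)

theorem pair_aux {k : ℕ} (hk : 1 ≤ k) (C₁ P₁ C₂ P₂ : Finset (Fin k → ℕ)) (n ℓ : ℕ) (R : ℝ)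
    (hR : R = 4 ^ (k + 1) * (k : ℝ) ^ ((k : ℝ) / 2) * (n : ℝ) ^ (3 * k + 1))
    (hP₁ : ∀ x ∈ P₁, ∀ i, x i ≤ n) (hP₂ : ∀ x ∈ P₂, ∀ i, x i ≤ n)
    (hC₁ : ∀ x ∈ C₁, ∀ i, x i ≤ ℓ) (hC₂ : ∀ x ∈ C₂, ∀ i, x i ≤ ℓ) :
    LSet C₁ P₁ ∩ LSet C₂ P₂ =
      LSet (boxSet ⌊(R + 1) * ℓ⌋₊ (LSet C₁ P₁ ∩ LSet C₂ P₂))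
        (boxSet ⌊R⌋₊ (LSet {0} P₁ ∩ LSet {0} P₂)) := by
  classical
  have hR0 : 0 ≤ R := by rw [hR]; positivity
  set C' := boxSet ⌊(R + 1) * ℓ⌋₊ (LSet C₁ P₁ ∩ LSet C₂ P₂) with hC'
  set P' := boxSet ⌊R⌋₊ (LSet {0} P₁ ∩ LSet {0} P₂) with hP'
  apply Set.Subset.antisymm
  · rcases Nat.eq_zero_or_pos n with hn0 | hn
    · -- trivial periods
      rintro v ⟨h1, h2⟩
      apply LSet_base
      rw [hC', mem_boxSet]
      refine ⟨fun i => Nat.le_floor ?_, h1, h2⟩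
      obtain ⟨c, hc, lam, rfl⟩ := h1
      have := sum_le_aux hP₁ lam i
      rw [hn0, zero_mul] at this
      have h3 : (c + ∑ x ∈ P₁, lam x • x) i ≤ ℓ := by
        have := hC₁ c hc i
        rw [Pi.add_apply]; omega
      have h4 : (((c + ∑ x ∈ P₁, lam x • x) i : ℕ) : ℝ) ≤ ℓ := by exact_mod_cast h3
      have : (0 : ℝ) ≤ ℓ := by positivity
      nlinarith
    · set K : ℝ := (k + 1) * ((k : ℝ) ^ ((k : ℝ) / 2) * (n : ℝ) ^ k) with hK
      have hK0 : 0 ≤ K := by rw [hK]; positivity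
      have hbound : ∀ l : ℕ, 1 ≤ l → (n : ℝ) * ((P₁.card + P₂.card + k + k * l) * K) ≤ R * l := by
        intro l hl
        rw [hR, hK]
        exact const_aux k n l hk hn hl _ _ _ (by positivity) (card_le_of_bdd hP₁)
          (card_le_of_bdd hP₂)
      have hnK : (n : ℝ) * K ≤ R := by
        have h1 := hbound 1 le_rfl
        have h2 : (1 : ℝ) * K ≤ (P₁.card + P₂.card + k + k * (1 : ℕ)) * K := by
          apply mul_le_mul_of_nonneg_right _ hK0
          have : (1 : ℝ) ≤ k := by exact_mod_cast hk
          push_cast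
          have : (0 : ℝ) ≤ P₁.card := by positivity
          have : (0 : ℝ) ≤ P₂.card := by positivity
          linarith
        have h3 := mul_le_mul_of_nonneg_left h2 (Nat.cast_nonneg (α := ℝ) n)
        rw [Nat.cast_one, mul_one] at h1
        rw [one_mul] at h3
        push_cast at h3
        linarith
      have main : ∀ (N : ℕ) (c : Fin k → ℕ), c ∈ C₁ → ∀ d ∈ C₂, ∀ lam mu : (Fin k → ℕ) → ℕ,
          ∑ x ∈ P₁, lam x + ∑ x ∈ P₂, mu x ≤ N →
          c + ∑ x ∈ P₁, lam x • x = d + ∑ x ∈ P₂, mu x • x →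
          c + ∑ x ∈ P₁, lam x • x ∈ LSet C' P' := by
        intro N
        induction N using Nat.strong_induction_on with
        | _ N ih =>
        intro c hc d hd lam mu hN heq
        have hmem : c + ∑ x ∈ P₁, lam x • x ∈ LSet C₁ P₁ ∩ LSet C₂ P₂ :=
          ⟨⟨c, hc, lam, rfl⟩, ⟨d, hd, mu, heq⟩⟩
        rcases one_step hk n ℓ hn P₁ P₂ hP₁ hP₂ c d (hC₁ c hc) (hC₂ d hd) lam mu heq K hK with
          ⟨l', m', hl, hm, hlm, hpos, hlK⟩ | hsmall
        · have s1 : ∑ x ∈ P₁, lam x = ∑ x ∈ P₁, (lam x - l' x) + ∑ x ∈ P₁, l' x := by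
            rw [← Finset.sum_add_distrib]
            exact Finset.sum_congr rfl fun x _ => (Nat.sub_add_cancel (hl x)).symm
          have s2 : ∑ x ∈ P₂, mu x = ∑ x ∈ P₂, (mu x - m' x) + ∑ x ∈ P₂, m' x := by
            rw [← Finset.sum_add_distrib]
            exact Finset.sum_congr rfl fun x _ => (Nat.sub_add_cancel (hm x)).symm
          have v1 : ∑ x ∈ P₁, lam x • x = ∑ x ∈ P₁, (lam x - l' x) • x + ∑ x ∈ P₁, l' x • x := by
            rw [← Finset.sum_add_distrib]
            exact Finset.sum_congr rfl fun x _ => by rw [← add_smul, Nat.sub_add_cancel (hl x)]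
          have v2 : ∑ x ∈ P₂, mu x • x = ∑ x ∈ P₂, (mu x - m' x) • x + ∑ x ∈ P₂, m' x • x := by
            rw [← Finset.sum_add_distrib]
            exact Finset.sum_congr rfl fun x _ => by rw [← add_smul, Nat.sub_add_cancel (hm x)]
          have hw : ∑ x ∈ P₁, l' x • x ∈ P' := by
            rw [hP', mem_boxSet]
            refine ⟨fun i => Nat.le_floor ?_, ⟨0, by simp, l', by simp⟩,
              ⟨0, by simp, m', by rw [zero_add, hlm]⟩⟩
            have h1 := sum_le_aux hP₁ l' i
            have h2 : (((∑ x ∈ P₁, l' x • x) i : ℕ) : ℝ) ≤ n * ((∑ x ∈ P₁, l' x : ℕ) : ℝ) := by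
              exact_mod_cast h1
            exact h2.trans ((mul_le_mul_of_nonneg_left hlK (by positivity)).trans hnK)
          have hrec := ih (∑ x ∈ P₁, (lam x - l' x) + ∑ x ∈ P₂, (mu x - m' x)) (by omega)
            c hc d hd (fun x => lam x - l' x) (fun x => mu x - m' x) le_rfl (by
              rw [v1, v2, ← add_assoc, ← add_assoc, hlm] at heq
              exact add_right_cancel heq)
          rw [v1, ← add_assoc]
          exact LSet_add_period hrec hw
        · have hval : ∀ i, (((∑ x ∈ P₁, lam x • x) i : ℕ) : ℝ) ≤
              n * ((P₁.card + P₂.card + k + k * ℓ) * K) := by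
            intro i
            have h1 := sum_le_aux hP₁ lam i
            have h2 : (((∑ x ∈ P₁, lam x • x) i : ℕ) : ℝ) ≤ n * ((∑ x ∈ P₁, lam x : ℕ) : ℝ) := by
              exact_mod_cast h1
            exact h2.trans (mul_le_mul_of_nonneg_left hsmall (by positivity))
          rcases Nat.eq_zero_or_pos ℓ with hℓ | hℓ
          · have hc0 : c = 0 := by
              ext i; have := hC₁ c hc i; simp; omega
            have hd0 : d = 0 := by
              ext i; have := hC₂ d hd i; simp; omega
            subst hc0 hd0
            have h0 : (0 : Fin k → ℕ) ∈ C' := by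
              rw [hC', mem_boxSet]
              exact ⟨fun i => Nat.zero_le _, LSet_base hc, LSet_base hd⟩
            refine LSet_add_period (LSet_base h0) ?_
            rw [hP', mem_boxSet]
            refine ⟨fun i => Nat.le_floor ?_, ⟨0, by simp, lam, by simp⟩,
              ⟨0, by simp, mu, by simpa using heq⟩⟩
            refine (hval i).trans ?_
            have h1 := hbound 1 le_rfl
            rw [Nat.cast_one, mul_one R] at h1
            refine le_trans ?_ h1
            apply mul_le_mul_of_nonneg_left _ (by positivity)
            apply mul_le_mul_of_nonneg_right _ hK0
            rw [hℓ]; simp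
          · apply LSet_base
            rw [hC', mem_boxSet]
            refine ⟨fun i => Nat.le_floor ?_, hmem⟩
            have h1 := hval i
            have h2 := hbound ℓ hℓ
            have h3 : (c i : ℝ) ≤ ℓ := by exact_mod_cast hC₁ c hc i
            rw [Pi.add_apply]
            push_cast
            push_cast at h1
            linarith
      rintro v ⟨⟨c, hc, lam, rfl⟩, ⟨d, hd, mu, heq⟩⟩
      exact main _ c hc d hd lam mu le_rfl heq
  · rintro v ⟨c, hc, lam, rfl⟩
    rw [hC', mem_boxSet] at hc
    have hPmem : ∀ w ∈ P', w ∈ LSet {0} P₁ ∩ LSet {0} P₂ := fun w hw => by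
      rw [hP', mem_boxSet] at hw; exact hw.2
    exact ⟨LSet_add_sum hc.2.1 (fun w hw => (hPmem w hw).1) lam,
      LSet_add_sum hc.2.2 (fun w hw => (hPmem w hw).2) lam⟩

/-- Intersection of two semilinear sets given by unions of `L(C_i, P_i)`,
with bounds on the index set and the norms of periods and constants. -/
theorem inter_semilinear_sets {ι : Type*} [DecidableEq ι] (k : ℕ) (hk : 1 ≤ k)
    (I J : Finset ι) (hIJ : Disjoint I J)
    (C P : ι → Finset (Fin k → ℕ))
    (p n ℓ : ℕ) (ak : ℝ)
    (hp : p = max I.card J.card)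
    (hn : n = (I ∪ J).sup fun i => snorm (P i))
    (hℓ : ℓ = (I ∪ J).sup fun i => snorm (C i))
    (hak : ak = 4 ^ (k + 1) * (k : ℝ) ^ ((k : ℝ) / 2)) :
    ∃ (H : Finset ℕ) (C' P' : ℕ → Finset (Fin k → ℕ)),
      H.card ≤ p ^ 2 * (ℓ + 1) ^ (2 * k) ∧
      (∀ h ∈ H,
        (snorm (P' h) : ℝ) ≤ ak * (n : ℝ) ^ (3 * k + 1) ∧
        (snorm (C' h) : ℝ) ≤ (ak * (n : ℝ) ^ (3 * k + 1) + 1) * (ℓ : ℝ)) ∧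
      ((⋃ i ∈ I, LSet (C i) (P i)) ∩ ⋃ j ∈ J, LSet (C j) (P j)) =
        ⋃ h ∈ H, LSet (C' h) (P' h) := by
  classical
  set R : ℝ := ak * (n : ℝ) ^ (3 * k + 1) with hRdef
  have hR : R = 4 ^ (k + 1) * (k : ℝ) ^ ((k : ℝ) / 2) * (n : ℝ) ^ (3 * k + 1) := by
    rw [hRdef, hak]
  have hR0 : 0 ≤ R := by rw [hR]; positivity
  have hPb : ∀ i ∈ I ∪ J, ∀ x ∈ P i, ∀ a, x a ≤ n := by
    intro i hi x hx a
    rw [hn]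
    exact (le_vnorm x a).trans ((vnorm_le_snorm hx).trans
      (Finset.le_sup (f := fun i => snorm (P i)) hi))
  have hCb : ∀ i ∈ I ∪ J, ∀ x ∈ C i, ∀ a, x a ≤ ℓ := by
    intro i hi x hx a
    rw [hℓ]
    exact (le_vnorm x a).trans ((vnorm_le_snorm hx).trans
      (Finset.le_sup (f := fun i => snorm (C i)) hi))
  set S := I ×ˢ J with hS
  let f : ℕ → Option (ι × ι) := fun m =>
    if h : m < S.card then some (S.equivFin.symm ⟨m, h⟩).1 else none
  let C' : ℕ → Finset (Fin k → ℕ) := fun m => (f m).elim ∅ fun q =>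
    boxSet ⌊(R + 1) * ℓ⌋₊ (LSet (C q.1) (P q.1) ∩ LSet (C q.2) (P q.2))
  let P' : ℕ → Finset (Fin k → ℕ) := fun m => (f m).elim ∅ fun q =>
    boxSet ⌊R⌋₊ (LSet {0} (P q.1) ∩ LSet {0} (P q.2))
  have hf : ∀ m (h : m < S.card), f m = some (S.equivFin.symm ⟨m, h⟩).1 := fun m h => dif_pos h
  have hpair : ∀ i ∈ I, ∀ j ∈ J, LSet (C i) (P i) ∩ LSet (C j) (P j) =
      LSet (boxSet ⌊(R + 1) * ℓ⌋₊ (LSet (C i) (P i) ∩ LSet (C j) (P j)))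
        (boxSet ⌊R⌋₊ (LSet {0} (P i) ∩ LSet {0} (P j))) := by
    intro i hi j hj
    have hi' := Finset.mem_union_left J hi
    have hj' := Finset.mem_union_right I hj
    exact pair_aux hk _ _ _ _ n ℓ R hR (hPb i hi') (hPb j hj') (hCb i hi') (hCb j hj')
  refine ⟨Finset.range S.card, C', P', ?_, ?_, ?_⟩
  · rw [Finset.card_range, hS, Finset.card_product]
    have h1 : I.card ≤ p := by rw [hp]; exact le_max_left _ _
    have h2 : J.card ≤ p := by rw [hp]; exact le_max_right _ _
    calc I.card * J.card ≤ p * p := Nat.mul_le_mul h1 h2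
      _ = p ^ 2 * 1 := by ring
      _ ≤ _ := Nat.mul_le_mul_left _ (Nat.one_le_pow _ _ (by omega))
  · intro m hm
    have hm' := Finset.mem_range.mp hm
    simp only [C', P', hf m hm', Option.elim_some]
    refine ⟨?_, ?_⟩
    · exact (Nat.cast_le.mpr snorm_boxSet).trans (Nat.floor_le hR0)
    · exact (Nat.cast_le.mpr snorm_boxSet).trans (Nat.floor_le (by positivity))
  · ext v
    simp only [Set.mem_inter_iff, Set.mem_iUnion, Finset.mem_range, exists_prop]
    constructor
    · rintro ⟨⟨i, hi, hv1⟩, ⟨j, hj, hv2⟩⟩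
      have hmem : (i, j) ∈ S := Finset.mem_product.mpr ⟨hi, hj⟩
      refine ⟨(S.equivFin ⟨_, hmem⟩).1, (S.equivFin ⟨_, hmem⟩).2, ?_⟩
      simp only [C', P', hf _ (S.equivFin ⟨_, hmem⟩).2, Option.elim_some, Fin.eta,
        Equiv.symm_apply_apply]
      rw [← hpair i hi j hj]
      exact ⟨hv1, hv2⟩
    · rintro ⟨m, hm, hv⟩
      simp only [C', P', hf m hm, Option.elim_some] at hv
      have hmem := (S.equivFin.symm ⟨m, hm⟩).2
      obtain ⟨hi, hj⟩ := Finset.mem_product.mp hmem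
      rw [← hpair _ hi _ hj] at hv
      exact ⟨⟨_, hi, hv.1⟩, ⟨_, hj, hv.2⟩⟩
end
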